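/- Let p and q be prime numbers with p ≡ 5 (mod 8) and q ≡ 3 (mod 8) (the Legendre symbol (p/q) may be 1 or −1). For every integer n ≥ 1, let ζ be a primitive 2^{n+2}-th root of unity and let L_n⁺ = ℚ(√p, √q, ζ + ζ⁻¹), the maximal real subfield of ℚ(√p, √q, ζ). Then the class number of L_n⁺ is odd; that is, the 2-class group of L_n⁺ is trivial. -/

import Mathlib

/-- The class number of a subfield `K` of `ℂ` (the cardinality of the class
group of its ring of integers). -/
noncomputable def classNum (K : IntermediateField ℚ ℂ) : ℕ :=
  Nat.card (ClassGroup (integralClosure ℤ K))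

/-- The 2-class group of a subfield `K` of `ℂ` (i.e. the 2-Sylow subgroup of
the class group of its ring of integers) is trivial. -/
def TwoClassGroupIsTrivial (K : IntermediateField ℚ ℂ) : Prop :=
  ∀ P : Sylow 2 (ClassGroup (integralClosure ℤ K)), P.toSubgroup = ⊥

section IndexOfDoubling

open Module

theorem finrank_of_addEquiv_free_prod_finite {M : Type*} {T : Type} [AddCommGroup M]
    [AddCommGroup T] [Finite T] {n : ℕ} (e : M ≃+ (Fin n → ℤ) × T) : finrank ℤ M = n := by
  rw [e.toIntLinearEquiv.finrank_eq]
  have h := LinearMap.rank_eq_of_surjective (f := LinearMap.fst ℤ (Fin n → ℤ) T)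
    LinearMap.fst_surjective
  have hker : Module.rank ℤ (LinearMap.ker (LinearMap.fst ℤ (Fin n → ℤ) T)) = 0 := by
    rw [rank_eq_zero_iff]
    rintro ⟨⟨a, t⟩, ht⟩
    simp only [LinearMap.mem_ker, LinearMap.fst_apply] at ht
    refine ⟨Nat.card T, by simp [Nat.card_pos.ne'], ?_⟩
    ext1
    simp [ht]
  rw [hker, add_zero] at h
  have := congrArg Cardinal.toNat h
  simpa [finrank] using this

theorem index_range_two_nsmul {M : Type*} [AddCommGroup M] [Module.Finite ℤ M] :
    (nsmulAddMonoidHom (α := M) 2).range.index =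
      2 ^ finrank ℤ M * Nat.card (nsmulAddMonoidHom (α := M) 2).ker := by
  have hfg : AddGroup.FG M := Module.Finite.iff_addGroup_fg.mp inferInstance
  obtain ⟨n, ι, _, p, hp, e, ⟨f₀⟩⟩ := AddCommGroup.equiv_free_prod_directSum_zmod M
  have : ∀ i, NeZero (p i ^ e i) := fun i ↦ ⟨(pow_pos (hp i).pos _).ne'⟩
  set T := (i : ι) → ZMod (p i ^ e i)
  let f : M ≃+ (Fin n → ℤ) × T :=
    f₀.trans (Finsupp.addEquivFunOnFinite.prodCongr (DirectSum.addEquivProd _))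
  rw [finrank_of_addEquiv_free_prod_finite f]
  have h1 : (nsmulAddMonoidHom (α := M) 2).range.index =
      (nsmulAddMonoidHom (α := (Fin n → ℤ) × T) 2).range.index := by
    simpa [AddEquiv.map_range_nsmulAddMonoidHom] using
      (AddSubgroup.index_map_equiv (nsmulAddMonoidHom (α := M) 2).range f).symm
  have h2 : (nsmulAddMonoidHom (α := (Fin n → ℤ) × T) 2).range =
      (nsmulAddMonoidHom (α := Fin n → ℤ) 2).range.prod
        (nsmulAddMonoidHom (α := T) 2).range := by
    ext ⟨a, t⟩
    simp only [AddSubgroup.mem_prod, AddMonoidHom.mem_range, nsmulAddMonoidHom_apply, Prod.exists,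
      Prod.smul_mk, Prod.mk.injEq]
    exact exists_and_exists_comm.symm
  have h3 : Nat.card (nsmulAddMonoidHom (α := M) 2).ker =
      Nat.card (nsmulAddMonoidHom (α := T) 2).ker := by
    refine Nat.card_congr ⟨fun x ↦ ⟨(f x).2, ?_⟩, fun t ↦ ⟨f.symm (0, t), ?_⟩, ?_, ?_⟩
    · have hx : 2 • (x : M) = 0 := x.2
      have := congrArg (fun y ↦ (f y).2) hx
      simpa [AddMonoidHom.mem_ker] using this
    · have ht : 2 • (t : T) = 0 := t.2
      have : (2 : ℕ) • ((0 : Fin n → ℤ), (t : T)) = 0 := by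
        rw [Prod.smul_mk, ht]; simp
      simp only [AddMonoidHom.mem_ker, nsmulAddMonoidHom_apply]
      rw [← map_nsmul, this, map_zero]
    · intro x
      have hx : 2 • (x : M) = 0 := x.2
      have h : 2 • (f x).1 = 0 := by
        have := congrArg (fun y ↦ (f y).1) hx
        simpa using this
      have h' : (f x).1 = 0 := (smul_eq_zero_iff_right two_ne_zero).1 h
      ext1
      simp only
      rw [AddEquiv.symm_apply_eq]
      exact Prod.ext h'.symm rfl
    · intro t
      simp
  rw [h1, h2, AddSubgroup.index_prod, AddSubgroup.index_range_nsmul, AddSubgroup.index_range, h3]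
  simp

theorem relIndex_map_two_nsmul {M : Type*} [AddCommGroup M] [Module.Finite ℤ M] {c : M}
    (hc : c ≠ 0) (htors : ∀ x : M, 2 • x = 0 ↔ x = 0 ∨ x = c) {S : AddSubgroup M} (hcS : c ∈ S) :
    (S.map (nsmulAddMonoidHom 2)).relIndex S = 2 ^ (finrank ℤ S + 1) := by
  have : Module.Finite ℤ S := inferInstanceAs (Module.Finite ℤ (AddSubgroup.toIntSubmodule S))
  have h1 : (S.map (nsmulAddMonoidHom 2)).relIndex S =
      (nsmulAddMonoidHom (α := S) 2).range.index := by
    rw [AddSubgroup.relIndex, AddSubgroup.addSubgroupOf_map_nsmulAddMonoidHom_eq_range]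
  have h2 : Nat.card (nsmulAddMonoidHom (α := S) 2).ker = 2 := by
    rw [Nat.card_eq_two_iff]
    refine ⟨0, ⟨⟨c, hcS⟩, ?_⟩, ?_, ?_⟩
    · have := (htors c).2 (Or.inr rfl)
      ext1
      exact this
    · intro h
      exact hc (congrArg (fun x : (nsmulAddMonoidHom (α := S) 2).ker ↦ ((x : S) : M)) h).symm
    · rw [Set.eq_univ_iff_forall]
      rintro ⟨⟨x, hx⟩, hx2⟩
      have : 2 • x = 0 := congrArg Subtype.val hx2
      rcases (htors x).1 this with rfl | rfl
      · left; rfl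
      · right; rfl
  rw [h1, index_range_two_nsmul, h2, pow_succ]

/-- Herbrand quotient of an involution `s` on a finitely generated abelian group whose
2-torsion is `{0, c}` and whose fixed part has less than half of the rank. -/
theorem two_mul_relIndex_range_add_le {M : Type*} [AddCommGroup M] [Module.Finite ℤ M] {c : M}
    (hc : c ≠ 0) (htors : ∀ x : M, 2 • x = 0 ↔ x = 0 ∨ x = c) (s : M →+ M)
    (hs : ∀ x, s (s x) = x) (P : AddSubgroup M) (hP : ∀ x, x ∈ P ↔ s x = x)
    (hrank : 2 * finrank ℤ P + 1 ≤ finrank ℤ M) :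
    2 * (AddMonoidHom.id M + s).range.relIndex P ≤
        (AddMonoidHom.id M - s).range.relIndex (AddMonoidHom.id M + s).ker ∧
      (AddMonoidHom.id M + s).range.relIndex P ≠ 0 ∧
      (AddMonoidHom.id M - s).range.relIndex (AddMonoidHom.id M + s).ker ≠ 0 := by
  set N := AddMonoidHom.id M + s with hN
  set D := AddMonoidHom.id M - s with hD
  have hNa : ∀ x, N x = x + s x := fun x ↦ rfl
  have hDa : ∀ x, D x = x - s x := fun x ↦ rfl
  have hsc : s c = c := by
    have h2 : 2 • s c = 0 := by rw [← map_nsmul, (htors c).2 (Or.inr rfl), map_zero]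
    rcases (htors _).1 h2 with h | h
    · exact absurd (by rw [← hs c, h, map_zero]) hc
    · exact h
  have hcP : c ∈ P := (hP c).2 hsc
  have hcN : c ∈ N.ker := by
    rw [AddMonoidHom.mem_ker, hNa, hsc, ← two_nsmul]
    exact (htors c).2 (Or.inr rfl)
  have hDk : D.ker = P := by
    ext x
    rw [AddMonoidHom.mem_ker, hDa, sub_eq_zero, hP, eq_comm]
  have hmapN : P.map N = P.map (nsmulAddMonoidHom 2) := by
    ext y
    simp only [AddSubgroup.mem_map]
    refine exists_congr fun x ↦ and_congr_right fun hx ↦ ?_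
    rw [hNa, (hP x).1 hx, nsmulAddMonoidHom_apply, two_nsmul]
  have hmapD : N.ker.map D = N.ker.map (nsmulAddMonoidHom 2) := by
    ext y
    simp only [AddSubgroup.mem_map]
    refine exists_congr fun x ↦ and_congr_right fun hx ↦ ?_
    rw [AddMonoidHom.mem_ker, hNa] at hx
    rw [hDa, neg_eq_of_add_eq_zero_right hx |>.symm, nsmulAddMonoidHom_apply, two_nsmul,
      sub_neg_eq_add]
  have hNP : N.range ≤ P := by
    rintro _ ⟨x, rfl⟩
    rw [hP, hNa, map_add, hs, add_comm]
  have hDN : D.range ≤ N.ker := by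
    rintro _ ⟨x, rfl⟩
    rw [AddMonoidHom.mem_ker, hNa, hDa, map_sub, hs]
    abel
  have h1 := AddSubgroup.relIndex_mul_relIndex _ _ _ (AddSubgroup.map_le_range N P) hNP
  have h2 := AddSubgroup.relIndex_mul_relIndex _ _ _ (AddSubgroup.map_le_range D N.ker) hDN
  rw [AddMonoidHom.range_eq_map N, AddSubgroup.relIndex_map_map, ← AddMonoidHom.range_eq_map,
    hmapN, relIndex_map_two_nsmul hc htors hcP, top_sup_eq] at h1
  rw [AddMonoidHom.range_eq_map D, AddSubgroup.relIndex_map_map, ← AddMonoidHom.range_eq_map,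
    hmapD, relIndex_map_two_nsmul hc htors hcN, hDk, sup_comm N.ker, top_sup_eq] at h2
  have hr1 : finrank ℤ N.range ≤ finrank ℤ P := by
    have : Module.Finite ℤ P := inferInstanceAs (Module.Finite ℤ (AddSubgroup.toIntSubmodule P))
    exact LinearMap.finrank_le_finrank_of_injective
      (f := (AddSubgroup.inclusion hNP).toIntLinearMap) (AddSubgroup.inclusion_injective hNP)
  have hr2 : finrank ℤ N.range + finrank ℤ N.ker = finrank ℤ M := by
    have := Submodule.finrank_quotient_add_finrank (LinearMap.ker N.toIntLinearMap)
    rw [N.toIntLinearMap.quotKerEquivRange.finrank_eq] at this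
    exact this
  have hle : finrank ℤ P + 1 ≤ finrank ℤ N.ker := by omega
  have hpos : ∀ m : ℕ, (2 : ℕ) ^ m ≠ 0 := fun m ↦ by positivity
  have hk : 2 * 2 ^ (finrank ℤ P + 1) ≤ 2 ^ (finrank ℤ N.ker + 1) := by
    rw [← pow_succ']
    exact Nat.pow_le_pow_right two_pos (by omega)
  have hne1 := hpos (finrank ℤ P + 1)
  have hne2 := hpos (finrank ℤ N.ker + 1)
  rw [← h1] at hk hne1
  rw [← h2] at hk hne2
  refine ⟨?_, right_ne_zero_of_mul hne1, right_ne_zero_of_mul hne2⟩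
  refine Nat.le_of_mul_le_mul_left ?_ (Nat.pos_of_ne_zero (left_ne_zero_of_mul hne1))
  calc _ = _ := mul_left_comm _ _ _
    _ ≤ _ := hk

end IndexOfDoubling

section QuadraticDedekind

open Ideal UniqueFactorizationMonoid

/-- Every ideal whose square is principal is principal. -/
def NoTwoTorsion (R : Type*) [CommRing R] : Prop :=
  ∀ (I : Ideal R) (b : R), I ^ 2 = span {b} → ∃ a, I = span {a}

/-- The features of a quadratic extension `B / A` of Dedekind domains with conjugation `σ` which
are needed for genus theory. -/
structure IsQuadraticPair (A : Type*) {B : Type*} [CommRing A] [CommRing B] [Algebra A B]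
    (σ : B →+* B) : Prop where
  algebraMap_injective : Function.Injective (algebraMap A B)
  map_algebraMap : ∀ a, σ (algebraMap A B a) = algebraMap A B a
  involutive : ∀ x, σ (σ x) = x
  exists_of_fixed : ∀ x, σ x = x → ∃ a, algebraMap A B a = x
  exists_anti : ∃ δ, δ ≠ 0 ∧ σ δ = -δ
  map_injective : Function.Injective (Ideal.map (algebraMap A B))
  map_comap : ∀ P : Ideal B, P.IsPrime → P ≠ ⊥ →
    (P.comap (algebraMap A B)).map (algebraMap A B) = P ∨
    ((P.comap (algebraMap A B)).map (algebraMap A B) = P * P.map σ ∧ P.map σ ≠ P) ∨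
    (P.comap (algebraMap A B)).map (algebraMap A B) = P ^ 2

/-- The ramified primes. -/
def ramifiedPrimes (A B : Type*) [CommRing A] [CommRing B] [Algebra A B] : Set (Ideal B) :=
  {P | P.IsPrime ∧ P ≠ ⊥ ∧ (P.comap (algebraMap A B)).map (algebraMap A B) = P ^ 2}

/-- The exponent of a prime in the factorization of an ideal. -/
noncomputable def primeExp {B : Type*} [CommRing B] [IsDedekindDomain B] (P I : Ideal B) : ℕ :=
  open Classical in (normalizedFactors I).count P

theorem primeExp_mul {B : Type*} [CommRing B] [IsDedekindDomain B] (P : Ideal B) {I J : Ideal B}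
    (hI : I ≠ ⊥) (hJ : J ≠ ⊥) : primeExp P (I * J) = primeExp P I + primeExp P J := by
  classical
  unfold primeExp
  rw [normalizedFactors_mul hI hJ, Multiset.count_add]

theorem primeExp_prime {B : Type*} [CommRing B] [IsDedekindDomain B] (P : Ideal B) {Q : Ideal B}
    (hQ : Q.IsPrime) (hQ0 : Q ≠ ⊥) (h : P ≠ Q) : primeExp P Q = 0 := by
  classical
  unfold primeExp
  rw [normalizedFactors_irreducible (prime_of_isPrime hQ0 hQ).irreducible, normalize_eq,
    Multiset.count_singleton, if_neg h]

theorem pow_dvd_iff_le_primeExp {B : Type*} [CommRing B] [IsDedekindDomain B] {P I : Ideal B}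
    (hP : P.IsPrime) (hP0 : P ≠ ⊥) (hI : I ≠ ⊥) {n : ℕ} : P ^ n ∣ I ↔ n ≤ primeExp P I := by
  classical
  unfold primeExp
  rw [pow_dvd_iff_le_emultiplicity,
    emultiplicity_eq_count_normalizedFactors (prime_of_isPrime hP0 hP).irreducible hI,
    normalize_eq, Nat.cast_le]

namespace IsQuadraticPair

variable {A B : Type*} [CommRing A] [CommRing B] [Algebra A B] {σ : B →+* B}

theorem map_map (h : IsQuadraticPair A σ) (I : Ideal B) : (I.map σ).map σ = I := by
  rw [Ideal.map_map]
  have : σ.comp σ = RingHom.id B := RingHom.ext h.involutive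
  rw [this, Ideal.map_id]

theorem map_algebraMap_ideal (h : IsQuadraticPair A σ) (J : Ideal A) :
    (J.map (algebraMap A B)).map σ = J.map (algebraMap A B) := by
  rw [Ideal.map_map]
  congr 1
  exact RingHom.ext h.map_algebraMap

/-- The conjugation as a ring equivalence. -/
def equiv (h : IsQuadraticPair A σ) : B ≃+* B where
  __ := σ
  invFun := σ
  left_inv := h.involutive
  right_inv := h.involutive

theorem map_isPrime (h : IsQuadraticPair A σ) {P : Ideal B} (hP : P.IsPrime) :
    (P.map σ).IsPrime := Ideal.map_isPrime_of_equiv h.equiv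

theorem map_ne_bot (h : IsQuadraticPair A σ) {I : Ideal B} (hI : I ≠ ⊥) : I.map σ ≠ ⊥ := by
  intro h0
  apply hI
  rw [← h.map_map I, h0, Ideal.map_bot]

theorem exists_norm (h : IsQuadraticPair A σ) (x : B) : ∃ a, algebraMap A B a = x * σ x :=
  h.exists_of_fixed _ (by rw [_root_.map_mul, h.involutive, mul_comm])

/-- Capitulation in a quadratic extension only kills 2-torsion. -/
theorem exists_span_of_map_eq_span (h : IsQuadraticPair A σ) (hA : NoTwoTorsion A) {J : Ideal A}
    {z : B} (hz : J.map (algebraMap A B) = span {z}) : ∃ a, J = span {a} := by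
  obtain ⟨a, ha⟩ := h.exists_norm z
  refine hA J a (h.map_injective ?_)
  have hz' : J.map (algebraMap A B) = span {σ z} := by
    rw [← h.map_algebraMap_ideal, hz, Ideal.map_span, Set.image_singleton]
  rw [Ideal.map_pow, Ideal.map_span, Set.image_singleton, ha, pow_two,
    ← span_singleton_mul_span_singleton, ← hz', ← hz]

theorem exists_hilbert90 [IsDomain B] (h : IsQuadraticPair A σ) {e : B} (he : e * σ e = 1) :
    ∃ γ, γ ≠ 0 ∧ e * σ γ = γ := by
  by_cases h1 : 1 + e = 0
  · obtain ⟨δ, hδ0, hδ⟩ := h.exists_anti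
    refine ⟨δ, hδ0, ?_⟩
    rw [hδ, eq_neg_of_add_eq_zero_right h1]
    ring
  · exact ⟨1 + e, h1, by rw [map_add, _root_.map_one, mul_add, he, mul_one, add_comm]⟩

variable [IsDedekindDomain B]

theorem map_eq_of_ramified (h : IsQuadraticPair A σ) {P : Ideal B} (hP : P ∈ ramifiedPrimes A B) :
    P.map σ = P := by
  obtain ⟨h1, h2, h3⟩ := hP
  have h4 := h.map_algebraMap_ideal (P.comap (algebraMap A B))
  rw [h3, Ideal.map_pow] at h4
  have h5 : P.map σ ∣ P ^ 2 := h4 ▸ dvd_pow_self _ two_ne_zero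
  have hp := prime_of_isPrime h2 h1
  have hp' := prime_of_isPrime (h.map_ne_bot h2) (h.map_isPrime h1)
  have h6 := hp'.dvd_of_dvd_pow h5
  exact associated_iff_eq.1 (hp'.irreducible.associated_of_dvd hp.irreducible h6)

theorem even_primeExp_map_comap (h : IsQuadraticPair A σ) {P Q : Ideal B} (hP : P.IsPrime)
    (hP0 : P ≠ ⊥) (hQ : Q ∈ ramifiedPrimes A B) :
    Even (primeExp Q ((P.comap (algebraMap A B)).map (algebraMap A B))) := by
  rcases h.map_comap P hP hP0 with h1 | ⟨h1, h2⟩ | h1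
  · rw [h1]
    rcases eq_or_ne Q P with rfl | hne
    · exfalso
      have := hQ.2.2
      rw [h1, pow_two] at this
      have h3 : Q = 1 := mul_left_cancel₀ hP0 (by rw [← this, mul_one])
      exact hP.ne_top (by rw [h3, Ideal.one_eq_top])
    · rw [primeExp_prime Q hP hP0 hne]; exact Even.zero
  · have hne : Q ≠ P := by
      rintro rfl
      exact h2 (h.map_eq_of_ramified hQ)
    have hne' : Q ≠ P.map σ := by
      rintro rfl
      have := h.map_eq_of_ramified hQ
      rw [h.map_map] at this
      exact h2 this.symm
    rw [h1, primeExp_mul _ hP0 (h.map_ne_bot hP0), primeExp_prime Q hP hP0 hne,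
      primeExp_prime Q (h.map_isPrime hP) (h.map_ne_bot hP0) hne']
    exact Even.zero
  · rw [h1, pow_two, primeExp_mul _ hP0 hP0]
    exact Even.add_self _

theorem map_comap_dvd (h : IsQuadraticPair A σ) {P I : Ideal B} (hP : P.IsPrime) (hP0 : P ≠ ⊥)
    (hI0 : I ≠ ⊥) (hI : I.map σ = I) (heven : ∀ Q ∈ ramifiedPrimes A B, Even (primeExp Q I))
    (hPI : P ∣ I) : (P.comap (algebraMap A B)).map (algebraMap A B) ∣ I := by
  rcases h.map_comap P hP hP0 with h1 | ⟨h1, h2⟩ | h1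
  · rwa [h1]
  · rw [h1]
    have hp := prime_of_isPrime hP0 hP
    have hp' := prime_of_isPrime (h.map_ne_bot hP0) (h.map_isPrime hP)
    have hd : P.map σ ∣ I := by
      rw [dvd_iff_le] at hPI ⊢
      rw [← hI]
      exact Ideal.map_mono hPI
    refine IsRelPrime.mul_dvd ?_ hPI hd
    rw [hp.irreducible.isRelPrime_iff_not_dvd]
    intro hdvd
    exact h2 (associated_iff_eq.1 (hp.irreducible.associated_of_dvd hp'.irreducible hdvd)).symm
  · rw [h1, pow_dvd_iff_le_primeExp hP hP0 hI0]
    have h3 : 1 ≤ primeExp P I := by rwa [← pow_dvd_iff_le_primeExp hP hP0 hI0, pow_one]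
    obtain ⟨k, hk⟩ := heven P ⟨hP, hP0, h1⟩
    omega

theorem exists_eq_map (h : IsQuadraticPair A σ) {I : Ideal B} (hI0 : I ≠ ⊥) (hI : I.map σ = I)
    (heven : ∀ Q ∈ ramifiedPrimes A B, Even (primeExp Q I)) :
    ∃ J : Ideal A, I = J.map (algebraMap A B) := by
  induction I using WellFoundedGT.induction with
  | _ I ih =>
  by_cases htop : I = ⊤
  · exact ⟨⊤, by rw [htop, Ideal.map_top]⟩
  obtain ⟨P, hPm, hIP⟩ := Ideal.exists_le_maximal I htop
  have hP := hPm.isPrime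
  have hP0 : P ≠ ⊥ := ne_bot_of_le_ne_bot hI0 hIP
  obtain ⟨I', hI'⟩ := h.map_comap_dvd hP hP0 hI0 hI heven (dvd_iff_le.2 hIP)
  set 𝔭 := P.comap (algebraMap A B)
  have hm0 : 𝔭.map (algebraMap A B) ≠ ⊥ := by
    intro h0
    apply hI0
    rw [hI', h0, Ideal.bot_mul]
  have hI'0 : I' ≠ ⊥ := by
    rintro rfl
    exact hI0 (by rw [hI', Ideal.mul_bot])
  have hI'σ : I'.map σ = I' := by
    have h1 := hI
    rw [hI', Ideal.map_mul, h.map_algebraMap_ideal] at h1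
    exact mul_left_cancel₀ hm0 h1
  have hlt : I < I' := Ideal.dvdNotUnit_iff_lt.1 ⟨hI'0, _, fun hu ↦ hP.ne_top
    (top_le_iff.1 (Ideal.isUnit_iff.1 hu ▸ Ideal.map_comap_le)), by rw [hI', mul_comm]⟩
  obtain ⟨J, hJ⟩ := ih I' hlt hI'0 hI'σ fun Q hQ ↦ by
    have h1 := heven Q hQ
    rw [hI', primeExp_mul _ hm0 hI'0, Nat.even_add] at h1
    exact h1.1 (h.even_primeExp_map_comap hP hP0 hQ)
  exact ⟨𝔭 * J, by rw [Ideal.map_mul, ← hJ, hI']⟩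

theorem primeExp_map_eq (h : IsQuadraticPair A σ) {Q I : Ideal B} (hQ : Q ∈ ramifiedPrimes A B)
    (hI : I ≠ ⊥) : primeExp Q (I.map σ) = primeExp Q I := by
  have key : ∀ (I : Ideal B) n, Q ^ n ∣ I → Q ^ n ∣ I.map σ := by
    intro I n hd
    rw [dvd_iff_le] at hd ⊢
    rw [← h.map_eq_of_ramified hQ, ← Ideal.map_pow]
    exact Ideal.map_mono hd
  have hle : ∀ I : Ideal B, I ≠ ⊥ → primeExp Q I ≤ primeExp Q (I.map σ) := fun I hI ↦
    (pow_dvd_iff_le_primeExp hQ.1 hQ.2.1 (h.map_ne_bot hI)).1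
      (key I _ ((pow_dvd_iff_le_primeExp hQ.1 hQ.2.1 hI).2 le_rfl))
  refine le_antisymm ?_ (hle I hI)
  have := hle _ (h.map_ne_bot hI)
  rwa [h.map_map] at this

end IsQuadraticPair

end QuadraticDedekind

section AmbiguousClasses

open Ideal Module

namespace IsQuadraticPair

variable {A B : Type*} [CommRing A] [CommRing B] [IsDomain A] [Algebra A B] {σ : B →+* B}

/-- The action of `σ` on the units. -/
noncomputable def unitsConj (σ : B →+* B) : Additive Bˣ →+ Additive Bˣ :=
  MonoidHom.toAdditive (Units.map (σ : B →* B))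

/-- The units fixed by `σ`. -/
def fixedUnits (σ : B →+* B) : AddSubgroup (Additive Bˣ) where
  carrier := {x | unitsConj σ x = x}
  add_mem' := fun {x y} hx hy ↦ by
    simp only [Set.mem_ofPred_eq] at *
    rw [map_add, hx, hy]
  zero_mem' := map_zero _
  neg_mem' := fun {x} hx ↦ by
    simp only [Set.mem_ofPred_eq] at *
    rw [map_neg, hx]

/-- The fixed units which are norms from the fraction field. -/
def normUnits (A : Type*) [CommRing A] [IsDomain A] [Algebra A B] [IsDomain B] (σ : B →+* B) :
    AddSubgroup (Additive Bˣ) where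
  carrier := {x | unitsConj σ x = x ∧ ∃ (b : B) (a : A), b ≠ 0 ∧ a ≠ 0 ∧
    b * σ b = (x.toMul : Bˣ) * (algebraMap A B a) ^ 2}
  add_mem' := by
    rintro x y ⟨hx, b, a, hb, ha, hab⟩ ⟨hy, b', a', hb', ha', hab'⟩
    refine ⟨by rw [map_add, hx, hy], b * b', a * a', mul_ne_zero hb hb', mul_ne_zero ha ha', ?_⟩
    rw [toMul_add, Units.val_mul, _root_.map_mul, _root_.map_mul]
    linear_combination (b' * σ b') * hab + (x.toMul : B) * algebraMap A B a ^ 2 * hab'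
  zero_mem' := ⟨map_zero _, 1, 1, one_ne_zero, one_ne_zero, by simp⟩
  neg_mem' := by
    rintro x ⟨hx, b, a, hb, ha, hab⟩
    have hx' : unitsConj σ (-x) = -x := by rw [map_neg, hx]
    refine ⟨hx', b * ((-x).toMul : Bˣ), a,
      mul_ne_zero hb (Units.ne_zero _), ha, ?_⟩
    have h1 : σ (((-x).toMul : Bˣ) : B) = ((-x).toMul : Bˣ) :=
      congrArg (fun y : Additive Bˣ ↦ ((y.toMul : Bˣ) : B)) hx'
    have h2 : (x.toMul : B) * (((-x).toMul : Bˣ) : B) = 1 := by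
      rw [toMul_neg, Units.mul_inv]
    rw [_root_.map_mul, h1]
    linear_combination (((-x).toMul : Bˣ) : B) ^ 2 * hab +
      (((-x).toMul : Bˣ) : B) * algebraMap A B a ^ 2 * h2

/-- Genus theory: the ambiguous class number formula, in the form of a criterion for the absence
of 2-torsion in the class group of `B`. -/
theorem noTwoTorsion_of_relIndex [IsDedekindDomain B] [CharZero B] [Module.Finite ℤ (Additive Bˣ)]
    (h : IsQuadraticPair A σ)
    (hrank : 2 * finrank ℤ (fixedUnits σ) + 1 ≤ finrank ℤ (Additive Bˣ))
    (hfin : (ramifiedPrimes A B).Finite)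
    (hcond : (normUnits A σ).relIndex (fixedUnits σ) ≠ 0 →
      2 ^ (ramifiedPrimes A B).ncard ≤ 2 * (normUnits A σ).relIndex (fixedUnits σ))
    (hA : NoTwoTorsion A) : NoTwoTorsion B := by
  classical
  have hinv : ∀ x : Additive Bˣ, unitsConj σ (unitsConj σ x) = x := fun x ↦
    Units.ext (h.involutive _)
  have htors : ∀ x : Additive Bˣ, 2 • x = 0 ↔ x = 0 ∨ x = Additive.ofMul (-1) := by
    intro x
    have : 2 • x = 0 ↔ ((x.toMul : Bˣ) : B) ^ 2 = 1 := by
      rw [← Units.val_pow_eq_pow_val, Units.val_eq_one]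
      rfl
    rw [this, sq_eq_one_iff]
    refine or_congr (Iff.trans Units.val_eq_one Iff.rfl) ?_
    rw [← Units.val_one, ← Units.val_neg, Units.val_inj]
    rfl
  have hne : Additive.ofMul (-1 : Bˣ) ≠ 0 := by
    intro h0
    have h1 : ((-1 : Bˣ) : B) = 1 := congrArg (fun y : Additive Bˣ ↦ ((y.toMul : Bˣ) : B)) h0
    rw [Units.val_neg, Units.val_one] at h1
    have : (2 : B) = 0 := by linear_combination -h1
    exact two_ne_zero this
  obtain ⟨hle, hne1, hne2⟩ := two_mul_relIndex_range_add_le hne htors (unitsConj σ) hinv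
    (fixedUnits σ) (fun _ ↦ Iff.rfl) hrank
  set N := AddMonoidHom.id (Additive Bˣ) + unitsConj σ with hN
  set D := AddMonoidHom.id (Additive Bˣ) - unitsConj σ with hD
  have hNval : ∀ x, ((N x).toMul : B) = x.toMul * σ (x.toMul : Bˣ) := fun x ↦ rfl
  -- elements generating invariant ideals
  have hker : ∀ e : N.ker,
      ((e : Additive Bˣ).toMul : B) * σ ((e : Additive Bˣ).toMul : Bˣ) = 1 := by
    intro e
    rw [← hNval, (AddMonoidHom.mem_ker).1 e.2]
    rfl
  choose γ hγ0 hγ using fun e : N.ker ↦ h.exists_hilbert90 (hker e)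
  have hγspan : ∀ e, (span {γ e}).map σ = span {γ e} := by
    intro e
    rw [Ideal.map_span, Set.image_singleton]
    conv_rhs => rw [← hγ e]
    rw [mul_comm, Ideal.span_singleton_mul_right_unit (Units.isUnit _)]
  have hspan0 : ∀ {x : B}, x ≠ 0 → span {x} ≠ ⊥ := fun hx ↦ by
    rwa [Ne, Ideal.span_singleton_eq_bot]
  let V := ↥(ramifiedPrimes A B) → ZMod 2
  have := hfin.to_subtype
  have hV : Nat.card V = 2 ^ (ramifiedPrimes A B).ncard := by
    rw [Nat.card_fun, Nat.card_zmod]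
    rfl
  let φ : N.ker → V := fun e P ↦ (primeExp P.1 (span {γ e}) : ZMod 2)
  have hφ : ∀ e e', φ e = φ e' → (e - e' : Additive Bˣ) ∈ D.range := by
    intro e e' hee
    have h1 : (span {γ e * γ e'}).map σ = span {γ e * γ e'} := by
      rw [← span_singleton_mul_span_singleton, Ideal.map_mul, hγspan, hγspan]
    obtain ⟨J, hJ⟩ := h.exists_eq_map (hspan0 (mul_ne_zero (hγ0 e) (hγ0 e'))) h1 (by
      intro Q hQ
      have h2 := congrFun hee ⟨Q, hQ⟩
      rw [← span_singleton_mul_span_singleton, primeExp_mul _ (hspan0 (hγ0 e)) (hspan0 (hγ0 e')),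
        ← ZMod.natCast_eq_zero_iff_even, Nat.cast_add]
      change (primeExp Q (span {γ e}) : ZMod 2) = (primeExp Q (span {γ e'}) : ZMod 2) at h2
      rw [h2, ← two_mul]
      exact mul_eq_zero_of_left rfl _)
    obtain ⟨a, ha⟩ := h.exists_span_of_map_eq_span hA hJ.symm
    rw [ha, Ideal.map_span, Set.image_singleton, Ideal.span_singleton_eq_span_singleton] at hJ
    obtain ⟨u, hu⟩ := hJ.symm
    have ha0 : algebraMap A B a ≠ 0 := by
      intro h0
      rw [h0, zero_mul] at hu
      exact mul_ne_zero (hγ0 e) (hγ0 e') hu.symm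
    -- `u` satisfies `e * e' * σ u = u`
    have h3 : ((e : Additive Bˣ).toMul : B) * ((e' : Additive Bˣ).toMul : Bˣ) * σ u = u := by
      refine mul_left_cancel₀ ha0 ?_
      have h4 := congrArg σ hu
      rw [_root_.map_mul, h.map_algebraMap, _root_.map_mul] at h4
      rw [hu]
      conv_rhs => rw [← hγ e, ← hγ e']
      linear_combination ((e : Additive Bˣ).toMul : B) * ((e' : Additive Bˣ).toMul : Bˣ) * h4
    have h5 : (e + e' : Additive Bˣ) = D (Additive.ofMul u) := by
      rw [hD, AddMonoidHom.sub_apply, eq_sub_iff_add_eq]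
      exact Units.ext h3
    have h6 : (2 • e' : Additive Bˣ) = D e' := by
      have : (e' : Additive Bˣ) + unitsConj σ e' = 0 := (AddMonoidHom.mem_ker).1 e'.2
      rw [hD, AddMonoidHom.sub_apply, (eq_neg_of_add_eq_zero_right this), two_nsmul]
      simp
    refine ⟨Additive.ofMul u - e', ?_⟩
    rw [map_sub, ← h5, ← h6, two_nsmul]
    abel
  let ψ : N.ker ⧸ D.range.addSubgroupOf N.ker → V := fun x ↦ φ x.out
  have hψ : Function.Injective ψ := by
    intro x y hxy
    have h1 := hφ _ _ hxy
    rw [← QuotientAddGroup.out_eq' x, ← QuotientAddGroup.out_eq' y, eq_comm, QuotientAddGroup.eq,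
      AddSubgroup.mem_addSubgroupOf]
    rwa [AddSubgroup.coe_add, AddSubgroup.coe_neg, neg_add_eq_sub]
  have : Finite V := inferInstance
  have hcard : D.range.relIndex N.ker ≤ Nat.card V := Nat.card_le_card_of_injective ψ hψ
  have hNU : N.range ≤ (normUnits A σ) := by
    rintro _ ⟨x, rfl⟩
    refine ⟨?_, x.toMul, 1, Units.ne_zero _, one_ne_zero, ?_⟩
    · rw [hN, AddMonoidHom.add_apply, map_add, hinv]
      exact add_comm _ _
    · rw [hNval, _root_.map_one]
      ring
  have hUP : (normUnits A σ) ≤ fixedUnits σ := fun x hx ↦ hx.1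
  have hmul := AddSubgroup.relIndex_mul_relIndex _ _ _ hNU hUP
  rw [← hmul] at hne1 hle
  rw [hV] at hcard
  have hne3 := right_ne_zero_of_mul hne1
  have hne4 := left_ne_zero_of_mul hne1
  have hcond := hcond hne3
  have hone : N.range.relIndex (normUnits A σ) = 1 := by
    have : N.range.relIndex (normUnits A σ) * (2 * (normUnits A σ).relIndex (fixedUnits σ)) ≤
      1 * (2 * (normUnits A σ).relIndex (fixedUnits σ)) := by linarith
    have := Nat.le_of_mul_le_mul_right this (by positivity)
    omega
  rw [hone, one_mul] at hle
  have hcardeq : Nat.card (N.ker ⧸ D.range.addSubgroupOf N.ker) = Nat.card V := by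
    rw [hV]
    exact le_antisymm hcard (hcond.trans hle)
  have hψs : Function.Surjective ψ := by
    have : Finite (N.ker ⧸ D.range.addSubgroupOf N.ker) := Finite.of_injective ψ hψ
    exact ((Nat.bijective_iff_injective_and_card ψ).2 ⟨hψ, hcardeq⟩).2
  have hUN : (normUnits A σ) ≤ N.range := AddSubgroup.relIndex_eq_one.1 hone
  -- the class of order two
  intro I b hIb
  by_cases hb0 : b = 0
  · refine ⟨0, ?_⟩
    rw [hb0, Ideal.span_singleton_zero] at hIb
    rw [Ideal.span_singleton_zero]
    exact eq_zero_of_pow_eq_zero hIb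
  have hI0 : I ≠ ⊥ := by
    rintro rfl
    apply hb0
    rw [← Ideal.span_singleton_eq_bot, ← hIb]
    simp [pow_two]
  have hIσ0 := h.map_ne_bot hI0
  obtain ⟨J, hJ⟩ := h.exists_eq_map (I := I * I.map σ) (mul_ne_zero hI0 hIσ0)
    (by rw [Ideal.map_mul, h.map_map, mul_comm]) (by
      intro Q hQ
      rw [primeExp_mul _ hI0 hIσ0, h.primeExp_map_eq hQ hI0]
      exact Even.add_self _)
  have hIσ : I.map σ ^ 2 = span {σ b} := by
    rw [← Ideal.map_pow, hIb, Ideal.map_span, Set.image_singleton]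
  have hJ2 : (J ^ 2).map (algebraMap A B) = span {b * σ b} := by
    rw [Ideal.map_pow, ← hJ, mul_pow, hIb, hIσ, span_singleton_mul_span_singleton]
  obtain ⟨a₂, ha₂⟩ := h.exists_span_of_map_eq_span hA hJ2
  obtain ⟨a, ha⟩ := hA J a₂ ha₂
  rw [ha, Ideal.span_singleton_pow, Ideal.map_span, Set.image_singleton,
    Ideal.span_singleton_eq_span_singleton, map_pow] at hJ2
  obtain ⟨ε, hε⟩ := hJ2
  have hbσ0 : b * σ b ≠ 0 := mul_ne_zero hb0 (by
    intro h0
    apply hb0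
    rw [← h.involutive b, h0, map_zero])
  have ha0 : algebraMap A B a ≠ 0 := by
    intro h0
    apply hbσ0
    rw [← hε, h0]
    ring
  have ha0' : a ≠ 0 := by
    rintro rfl
    exact ha0 (map_zero _)
  have hεσ : σ (ε : B) = ε := by
    have h1 := congrArg σ hε
    rw [_root_.map_mul, _root_.map_mul, map_pow, h.map_algebraMap, h.involutive] at h1
    refine mul_left_cancel₀ (pow_ne_zero 2 ha0) ?_
    rw [h1, hε, mul_comm]
  obtain ⟨η, hη⟩ := hUN (x := Additive.ofMul ε)
    ⟨Units.ext hεσ, b, a, hb0, ha0', by rw [← hε, mul_comm]; rfl⟩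
  have hη' : (η.toMul : B) * σ (η.toMul : Bˣ) = ε := by
    rw [← hNval, hη]
    rfl
  -- modify `b` by the unit `η`
  set ι : B := ((η.toMul⁻¹ : Bˣ) : B) with hι
  have hιη : ι * (η.toMul : Bˣ) = 1 := Units.inv_mul _
  have hισ : σ ι * σ (η.toMul : Bˣ) = 1 := by rw [← _root_.map_mul, hιη, _root_.map_one]
  have hnorm : (b * ι) * σ (b * ι) = algebraMap A B a ^ 2 := by
    rw [_root_.map_mul]
    calc b * ι * (σ b * σ ι) = ι * σ ι * (b * σ b) := by ring
      _ = ι * σ ι * (algebraMap A B a ^ 2 * ((η.toMul : Bˣ) * σ (η.toMul : Bˣ))) := by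
        rw [← hε, hη']
      _ = algebraMap A B a ^ 2 * (ι * (η.toMul : Bˣ)) * (σ ι * σ (η.toMul : Bˣ)) := by ring
      _ = _ := by rw [hιη, hισ]; ring
  have hIJ : I * span {algebraMap A B a} = span {b * ι} * I.map σ := by
    have h1 : I * I.map σ = span {algebraMap A B a} := by
      rw [hJ, ha, Ideal.map_span, Set.image_singleton]
    have h2 : span {b * ι} = I ^ 2 := by
      rw [hIb, Ideal.span_singleton_mul_right_unit (Units.isUnit _)]
    rw [← h1, h2]
    ring
  obtain ⟨g, hg0, hg⟩ : ∃ g, g ≠ 0 ∧ (I * span {g}).map σ = I * span {g} := by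
    by_cases h0 : algebraMap A B a + b * ι = 0
    · refine ⟨1, one_ne_zero, ?_⟩
      rw [eq_neg_of_add_eq_zero_right h0, Ideal.span_singleton_neg, mul_comm] at hIJ
      have := mul_left_cancel₀ (hspan0 ha0) hIJ
      rw [Ideal.span_singleton_one, Ideal.mul_top, ← this]
    · have h0' : algebraMap A B a + σ (b * ι) ≠ 0 := by
        intro h1
        apply h0
        rw [← h.involutive (algebraMap A B a + b * ι), map_add, h.map_algebraMap, h1, map_zero]
      refine ⟨algebraMap A B a + σ (b * ι), h0', mul_left_cancel₀ (hspan0 ha0) ?_⟩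
      rw [Ideal.map_mul, Ideal.map_span, Set.image_singleton, map_add, h.map_algebraMap,
        h.involutive]
      calc span {algebraMap A B a} * (I.map σ * span {algebraMap A B a + b * ι})
          = I.map σ * span {algebraMap A B a * (algebraMap A B a + b * ι)} := by
            rw [← span_singleton_mul_span_singleton]; ring
        _ = I.map σ * span {(b * ι) * (algebraMap A B a + σ (b * ι))} := by
            congr 3
            rw [mul_add, mul_add, hnorm]
            ring
        _ = (span {b * ι} * I.map σ) * span {algebraMap A B a + σ (b * ι)} := by
            rw [← span_singleton_mul_span_singleton]; ring
        _ = _ := by rw [← hIJ]; ring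
  obtain ⟨x, hx⟩ := hψs (fun P ↦ (primeExp P.1 (I * span {g}) : ZMod 2))
  set e := x.out
  have hIg0 : I * span {g} ≠ ⊥ := mul_ne_zero hI0 (hspan0 hg0)
  obtain ⟨J', hJ'⟩ := h.exists_eq_map (I := I * span {g} * span {γ e})
    (mul_ne_zero hIg0 (hspan0 (hγ0 e))) (by rw [Ideal.map_mul, hg, hγspan]) (by
      intro Q hQ
      rw [primeExp_mul _ hIg0 (hspan0 (hγ0 e)), ← ZMod.natCast_eq_zero_iff_even, Nat.cast_add]
      have h2 : (primeExp Q (span {γ e}) : ZMod 2) = primeExp Q (I * span {g}) :=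
        congrFun hx ⟨Q, hQ⟩
      rw [h2, ← two_mul]
      exact mul_eq_zero_of_left rfl _)
  have hJ'2 : (J' ^ 2).map (algebraMap A B) = span {b * g ^ 2 * γ e ^ 2} := by
    rw [Ideal.map_pow, ← hJ', mul_pow, mul_pow, hIb, Ideal.span_singleton_pow,
      Ideal.span_singleton_pow, span_singleton_mul_span_singleton,
      span_singleton_mul_span_singleton]
  obtain ⟨c₂, hc₂⟩ := h.exists_span_of_map_eq_span hA hJ'2
  obtain ⟨c, hc⟩ := hA J' c₂ hc₂
  rw [hc, Ideal.map_span, Set.image_singleton, mul_assoc, span_singleton_mul_span_singleton] at hJ'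
  have hdvd : g * γ e ∣ algebraMap A B c := by
    rw [← Ideal.span_singleton_le_span_singleton, ← hJ']
    exact Ideal.mul_le_right
  obtain ⟨d, hd⟩ := hdvd
  refine ⟨d, ?_⟩
  rw [hd, mul_comm, ← span_singleton_mul_span_singleton (g * γ e) d] at hJ'
  exact mul_left_cancel₀ (hspan0 (mul_ne_zero hg0 (hγ0 e))) hJ'

end IsQuadraticPair

end AmbiguousClasses

section QuadraticNumberField

open Ideal Module NumberField

variable {F K : Type*} [Field F] [Field K] [Algebra F K]

/-- The conjugation induced on the ring of integers. -/
noncomputable def integerConj (σ : Gal(K/F)) : 𝓞 K →+* 𝓞 K :=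
  RingOfIntegers.mapRingHom (σ : K →+* K)

theorem coe_integerConj (σ : Gal(K/F)) (x : 𝓞 K) : (integerConj σ x : K) = σ x := rfl

variable (F) [NumberField F] [NumberField K]

theorem absNorm_comap_pow_eq (P : Ideal (𝓞 K)) [P.IsPrime] (hP0 : P ≠ ⊥) :
    ∃ k, k ≠ 0 ∧ absNorm P = absNorm (P.under (𝓞 F)) ^ k := by
  have hPm : P.IsMaximal := Ring.DimensionLEOne.maximalOfPrime hP0 ‹_›
  have hm : (P.under (𝓞 F)).IsMaximal := inferInstance
  let _ := Ideal.Quotient.field (P.under (𝓞 F))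
  refine ⟨finrank (𝓞 F ⧸ P.under (𝓞 F)) (𝓞 K ⧸ P), finrank_pos.ne', ?_⟩
  rw [absNorm_apply, absNorm_apply, Submodule.cardQuot_apply, Submodule.cardQuot_apply]
  exact Module.natCard_eq_pow_finrank

variable {F}

theorem absNorm_map_algebraMap (hd : finrank F K = 2) (I : Ideal (𝓞 F)) :
    absNorm (I.map (algebraMap (𝓞 F) (𝓞 K))) = absNorm I ^ 2 := by
  rw [Ideal.absNorm_algebraMap, ← IsFractionRing.finrank_eq (𝓞 F) F (𝓞 K) K, hd]

theorem one_lt_absNorm {P : Ideal (𝓞 K)} (hP : P.IsPrime) (hP0 : P ≠ ⊥) : 1 < absNorm P := by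
  have h1 : absNorm P ≠ 0 := by rwa [Ne, Ideal.absNorm_eq_zero_iff]
  have h2 : absNorm P ≠ 1 := by
    rw [Ne, Ideal.absNorm_eq_one_iff]
    exact hP.ne_top
  omega

theorem involutive_of_finrank_eq_two (hd : finrank F K = 2) (σ : Gal(K/F)) (x : K) :
    σ (σ x) = x := by
  have : Algebra.IsQuadraticExtension F K := ⟨hd⟩
  have h1 := IsGalois.card_aut_eq_finrank F K
  have h2 : σ ^ 2 = 1 := by rw [← hd, ← h1, pow_card_eq_one']
  rw [pow_two] at h2
  exact DFunLike.congr_fun h2 x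

theorem exists_of_fixed_of_finrank_eq_two (hd : finrank F K = 2) {σ : Gal(K/F)} (hσ : σ ≠ 1)
    {x : K} (hx : σ x = x) : ∃ a, algebraMap F K a = x := by
  have : Algebra.IsQuadraticExtension F K := ⟨hd⟩
  have h1 := IsGalois.card_aut_eq_finrank F K
  rw [hd, Nat.card_eq_two_iff' (1 : Gal(K/F))] at h1
  have h2 := (IsGalois.mem_bot_iff_fixed (F := F) x).2 fun τ ↦ by
    by_cases hτ : τ = 1
    · rw [hτ, AlgEquiv.one_apply]
    · rw [h1.unique hτ hσ, hx]
  exact IntermediateField.mem_bot.1 h2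

theorem mem_map_integerConj (hd : finrank F K = 2) (σ : Gal(K/F)) {P : Ideal (𝓞 K)} {x : 𝓞 K} :
    x ∈ P.map (integerConj σ) ↔ integerConj σ x ∈ P := by
  have hinv : ∀ x, integerConj σ (integerConj σ x) = x := fun x ↦
    RingOfIntegers.ext (involutive_of_finrank_eq_two hd σ x)
  constructor
  · intro hx
    have h1 := Ideal.mem_map_of_mem (integerConj σ) hx
    rw [Ideal.map_map] at h1
    have : (integerConj σ).comp (integerConj σ) = RingHom.id _ := RingHom.ext hinv
    rwa [this, Ideal.map_id] at h1
  · intro hx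
    rw [← hinv x]
    exact Ideal.mem_map_of_mem _ hx

theorem le_map_of_under_eq (hd : finrank F K = 2) {σ : Gal(K/F)} (hσ : σ ≠ 1)
    {P Q : Ideal (𝓞 K)} (hP : P.IsPrime) (hQ : Q.IsMaximal)
    (h : Q.under (𝓞 F) = P.under (𝓞 F)) (hPQ : P ≠ Q) : Q ≤ P.map (integerConj σ) := by
  by_contra hle
  have h1 : ¬ (Q : Set (𝓞 K)) ⊆ P ∪ P.map (integerConj σ) := by
    rw [Ideal.subset_union]
    rintro (h1 | h1)
    · exact hPQ (hQ.eq_of_le hP.ne_top h1).symm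
    · exact hle h1
  rw [Set.not_subset] at h1
  obtain ⟨x, hxQ, hx⟩ := h1
  rw [Set.mem_union, not_or, SetLike.mem_coe, SetLike.mem_coe, mem_map_integerConj hd] at hx
  have h2 : σ (x * σ x) = x * σ x := by
    rw [_root_.map_mul, involutive_of_finrank_eq_two hd, mul_comm]
  obtain ⟨a, ha⟩ := exists_of_fixed_of_finrank_eq_two hd hσ h2
  have hai : IsIntegral ℤ a := by
    rw [← isIntegral_algebraMap_iff (algebraMap F K).injective, ha]
    exact (x * integerConj σ x).2
  obtain ⟨a, rfl⟩ : ∃ a' : 𝓞 F, (a' : F) = a := ⟨⟨a, hai⟩, rfl⟩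
  have h3 : algebraMap (𝓞 F) (𝓞 K) a = x * integerConj σ x := RingOfIntegers.ext ha
  have h4 : a ∈ Q.under (𝓞 F) := by
    rw [Ideal.under_def, Ideal.mem_comap, h3]
    exact Ideal.mul_mem_right _ _ hxQ
  rw [h, Ideal.under_def, Ideal.mem_comap, h3] at h4
  rcases hP.mem_or_mem h4 with h5 | h5
  · exact hx.1 h5
  · exact hx.2 h5

theorem isQuadraticPair_integerConj (hd : finrank F K = 2) {σ : Gal(K/F)} (hσ : σ ≠ 1) :
    IsQuadraticPair (𝓞 F) (integerConj σ) := by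
  have hinv : ∀ x, integerConj σ (integerConj σ x) = x := fun x ↦
    RingOfIntegers.ext (involutive_of_finrank_eq_two hd σ x)
  have hmapmap (I : Ideal (𝓞 K)) : (I.map (integerConj σ)).map (integerConj σ) = I := by
    rw [Ideal.map_map]
    have : (integerConj σ).comp (integerConj σ) = RingHom.id _ := RingHom.ext hinv
    rw [this, Ideal.map_id]
  let τ : 𝓞 K ≃+* 𝓞 K :=
    { integerConj σ with invFun := integerConj σ, left_inv := hinv, right_inv := hinv }
  refine ⟨FaithfulSMul.algebraMap_injective _ _, fun a ↦ RingOfIntegers.ext (σ.commutes a), hinv,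
    fun x hx ↦ ?_, ?_, ?_, fun P hP hP0 ↦ ?_⟩
  · obtain ⟨a, ha⟩ := exists_of_fixed_of_finrank_eq_two hd hσ
      (congrArg (fun y : 𝓞 K ↦ (y : K)) hx)
    refine ⟨⟨a, ?_⟩, RingOfIntegers.ext ha⟩
    rw [mem_integralClosure_iff, ← isIntegral_algebraMap_iff (algebraMap F K).injective, ha]
    exact x.2
  · by_contra! h
    apply hσ
    have h1 : ∀ x : 𝓞 K, integerConj σ x = x := by
      intro x
      by_contra hx
      refine h (x - integerConj σ x) (sub_ne_zero.2 (Ne.symm hx)) ?_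
      rw [map_sub, hinv, neg_sub]
    ext x
    obtain ⟨a, b, _, rfl⟩ := IsFractionRing.div_surjective (A := 𝓞 K) x
    rw [map_div₀, ← RingOfIntegers.coe_eq_algebraMap, ← RingOfIntegers.coe_eq_algebraMap,
      ← coe_integerConj, ← coe_integerConj, h1, h1]
    rfl
  · exact Function.LeftInverse.injective (g := Ideal.comap (algebraMap (𝓞 F) (𝓞 K)))
      fun I ↦ Ideal.comap_map_eq_self_of_faithfullyFlat I
  · have hPm : P.IsMaximal := Ring.DimensionLEOne.maximalOfPrime hP0 ‹_›
    have hp := prime_of_isPrime hP0 hP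
    change (P.under (𝓞 F)).map _ = _ ∨ ((P.under (𝓞 F)).map _ = _ ∧ _) ∨ (P.under (𝓞 F)).map _ = _
    set 𝔭 := P.under (𝓞 F) with h𝔭
    obtain ⟨J, hJ⟩ : P ∣ 𝔭.map (algebraMap (𝓞 F) (𝓞 K)) := dvd_iff_le.2 Ideal.map_comap_le
    obtain ⟨k, hk0, hk⟩ := absNorm_comap_pow_eq F P hP0
    have hN := absNorm_map_algebraMap hd 𝔭
    rw [hJ, _root_.map_mul, hk] at hN
    have h𝔭0 : 𝔭 ≠ ⊥ := by
      intro h0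
      have := one_lt_absNorm hP hP0
      rw [hk, ← h𝔭, h0, absNorm_bot, zero_pow hk0] at this
      omega
    have h𝔭1 : 1 < absNorm 𝔭 := one_lt_absNorm (K := F) inferInstance h𝔭0
    rw [← h𝔭] at hN
    have hk2 : k ≤ 2 := by
      rw [← Nat.pow_le_pow_iff_right h𝔭1]
      exact Nat.le_of_dvd (by positivity) ⟨_, hN.symm⟩
    obtain rfl | rfl : k = 1 ∨ k = 2 := by omega
    · have hNJ : absNorm J = absNorm 𝔭 := by
        rw [pow_one, pow_two] at hN
        exact Nat.eq_of_mul_eq_mul_left (by omega) hN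
      have hm0 : 𝔭.map (algebraMap (𝓞 F) (𝓞 K)) ≠ ⊥ := by
        rw [Ne, Ideal.map_eq_bot_iff_of_injective (FaithfulSMul.algebraMap_injective _ _)]
        exact h𝔭0
      have hJ0 : J ≠ ⊥ := by
        rintro rfl
        exact hm0 (by rw [hJ, Ideal.mul_bot])
      obtain ⟨Q, hQm, hJQ⟩ := Ideal.exists_le_maximal J (by
        rw [Ne, ← Ideal.absNorm_eq_one_iff, hNJ]
        omega)
      have hQ0 : Q ≠ ⊥ := ne_bot_of_le_ne_bot hJ0 hJQ
      have hQu : Q.under (𝓞 F) = 𝔭 := by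
        have h1 : 𝔭 ≤ Q.under (𝓞 F) := by
          rw [Ideal.under_def, ← Ideal.map_le_iff_le_comap, hJ]
          exact Ideal.mul_le_right.trans hJQ
        have : 𝔭.IsMaximal := inferInstance
        exact (this.eq_of_le (Ideal.IsPrime.ne_top inferInstance) h1).symm
      have hQJ : J = Q := by
        obtain ⟨J', hJ'⟩ := dvd_iff_le.2 hJQ
        obtain ⟨l, hl0, hl⟩ := absNorm_comap_pow_eq F Q hQ0
        have h1 : absNorm J ∣ absNorm Q := by
          rw [hNJ, hl, hQu]
          exact dvd_pow_self _ hl0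
        rw [hJ', _root_.map_mul] at h1
        have hQ1 := one_lt_absNorm hQm.isPrime hQ0
        have h2 : absNorm J' = 1 := by
          have := Nat.le_of_dvd (by omega) h1
          have h3 : absNorm J' ≠ 0 := by
            intro h0
            rw [h0, mul_zero, zero_dvd_iff] at h1
            omega
          have h4 : absNorm J' ≤ 1 := by
            by_contra!
            nlinarith
          omega
        rw [hJ', Ideal.absNorm_eq_one_iff.1 h2, Ideal.mul_top]
      subst hQJ
      by_cases hPJ : P = J
      · right; right
        rw [hJ, ← hPJ, pow_two]
      · right; left
        have h1 := le_map_of_under_eq hd hσ hP hQm hQu hPJ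
        have hσP : (P.map (integerConj σ)).IsPrime := Ideal.map_isPrime_of_equiv τ
        have h2 := hQm.eq_of_le hσP.ne_top h1
        rw [← h2]
        exact ⟨hJ, Ne.symm hPJ⟩
    · left
      have : absNorm J = 1 := by
        have : 0 < absNorm 𝔭 ^ 2 := by positivity
        exact Nat.eq_of_mul_eq_mul_left this (by rw [hN, mul_one])
      rw [hJ, Ideal.absNorm_eq_one_iff.1 this, Ideal.mul_top]

theorem sub_integerConj_mem (hd : finrank F K = 2) {σ : Gal(K/F)} (hσ : σ ≠ 1) {P : Ideal (𝓞 K)}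
    (hP : P ∈ ramifiedPrimes (𝓞 F) (𝓞 K)) (x : 𝓞 K) : x - integerConj σ x ∈ P := by
  have h := isQuadraticPair_integerConj hd hσ
  have hPσ := h.map_eq_of_ramified hP
  have hPr := hP.1
  have hN := absNorm_map_algebraMap hd (P.under (𝓞 F))
  rw [show (P.under (𝓞 F)).map (algebraMap (𝓞 F) (𝓞 K)) = P ^ 2 from hP.2.2, map_pow,
    Nat.pow_left_inj two_ne_zero, absNorm_apply, absNorm_apply, Submodule.cardQuot_apply,
    Submodule.cardQuot_apply] at hN
  have : Finite (𝓞 K ⧸ P) := Ideal.finiteQuotientOfFreeOfNeBot P hP.2.1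
  have hbij : Function.Bijective (algebraMap (𝓞 F ⧸ P.under (𝓞 F)) (𝓞 K ⧸ P)) := by
    rw [Nat.bijective_iff_injective_and_card]
    exact ⟨Ideal.algebraMap_quotient_injective, hN.symm⟩
  obtain ⟨y, hy⟩ := hbij.2 (Ideal.Quotient.mk P x)
  obtain ⟨a, rfl⟩ := Ideal.Quotient.mk_surjective y
  rw [Ideal.Quotient.algebraMap_mk_of_liesOver, eq_comm, Ideal.Quotient.eq] at hy
  have h2 : integerConj σ (x - algebraMap (𝓞 F) (𝓞 K) a) ∈ P := by
    rw [← mem_map_integerConj hd, hPσ]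
    exact hy
  rw [map_sub, h.map_algebraMap] at h2
  convert P.sub_mem hy h2 using 1
  ring

end QuadraticNumberField

section TotallyReal

open Ideal Module NumberField

variable {F K : Type*} [Field F] [Field K] [NumberField F] [NumberField K] [Algebra F K]

theorem mem_fixedUnits_iff (hd : finrank F K = 2) {σ : Gal(K/F)} (hσ : σ ≠ 1)
    {x : Additive (𝓞 K)ˣ} : x ∈ IsQuadraticPair.fixedUnits (integerConj σ) ↔
    ∃ u : (𝓞 F)ˣ, ((x.toMul : (𝓞 K)ˣ) : 𝓞 K) = algebraMap (𝓞 F) (𝓞 K) u := by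
  have h := isQuadraticPair_integerConj hd hσ
  constructor
  · intro hx
    have fixed : ∀ y ∈ IsQuadraticPair.fixedUnits (integerConj σ),
        ∃ a, algebraMap (𝓞 F) (𝓞 K) a = (y.toMul : (𝓞 K)ˣ) := fun y hy ↦
      h.exists_of_fixed _ (congrArg (fun z : Additive (𝓞 K)ˣ ↦ ((z.toMul : (𝓞 K)ˣ) : 𝓞 K)) hy)
    obtain ⟨a, ha⟩ := fixed x hx
    obtain ⟨b, hb⟩ := fixed (-x) (neg_mem hx)
    have hab : a * b = 1 := by
      apply h.algebraMap_injective
      rw [_root_.map_mul, ha, hb, _root_.map_one, toMul_neg, Units.mul_inv]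
    exact ⟨⟨a, b, hab, by rw [mul_comm, hab]⟩, ha.symm⟩
  · rintro ⟨u, hu⟩
    refine Additive.toMul.injective (Units.ext ?_)
    change integerConj σ (x.toMul : (𝓞 K)ˣ) = (x.toMul : (𝓞 K)ˣ)
    rw [hu, h.map_algebraMap]

theorem finrank_fixedUnits (hd : finrank F K = 2) {σ : Gal(K/F)} (hσ : σ ≠ 1) :
    finrank ℤ (IsQuadraticPair.fixedUnits (integerConj σ)) = finrank ℤ (Additive (𝓞 F)ˣ) := by
  have h := isQuadraticPair_integerConj hd hσ
  let f : Additive (𝓞 F)ˣ →+ Additive (𝓞 K)ˣ :=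
    MonoidHom.toAdditive (Units.map (algebraMap (𝓞 F) (𝓞 K) : 𝓞 F →* 𝓞 K))
  have hf : ∀ x, f x ∈ IsQuadraticPair.fixedUnits (integerConj σ) := fun x ↦
    (mem_fixedUnits_iff hd hσ).2 ⟨x.toMul, rfl⟩
  refine (AddEquiv.ofBijective (f.codRestrict _ hf) ⟨fun x y hxy ↦ ?_, fun x ↦ ?_⟩
    ).toIntLinearEquiv.finrank_eq.symm
  · refine Additive.toMul.injective (Units.ext (h.algebraMap_injective ?_))
    exact congrArg (fun z : IsQuadraticPair.fixedUnits (integerConj σ) ↦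
      (((z : Additive (𝓞 K)ˣ).toMul : (𝓞 K)ˣ) : 𝓞 K)) hxy
  · obtain ⟨u, hu⟩ := (mem_fixedUnits_iff hd hσ).1 x.2
    exact ⟨Additive.ofMul u, Subtype.ext (Additive.toMul.injective (Units.ext hu.symm))⟩

theorem finrank_units_of_isTotallyReal (K : Type*) [Field K] [NumberField K] [IsTotallyReal K] :
    finrank ℤ (Additive (𝓞 K)ˣ) + 1 = finrank ℚ K := by
  classical
  rw [NumberField.Units.finrank_eq, NumberField.Units.rank, IsTotallyReal.finrank,
    InfinitePlace.card_eq_nrRealPlaces_add_nrComplexPlaces,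
    IsTotallyReal.nrComplexPlaces_eq_zero, add_zero]
  have := IsTotallyReal.finrank K
  have : 0 < finrank ℚ K := finrank_pos
  omega

theorem two_mul_finrank_fixedUnits_add_one_le [IsTotallyReal K] (hd : finrank F K = 2)
    {σ : Gal(K/F)} (hσ : σ ≠ 1) :
    2 * finrank ℤ (IsQuadraticPair.fixedUnits (integerConj σ)) + 1 ≤
      finrank ℤ (Additive (𝓞 K)ˣ) := by
  have : IsTotallyReal F := IsTotallyReal.of_algebra F K
  have h1 := finrank_units_of_isTotallyReal K
  have h2 := finrank_units_of_isTotallyReal F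
  have h3 := Module.finrank_mul_finrank ℚ F K
  rw [finrank_fixedUnits hd hσ]
  rw [hd] at h3
  omega

/-- A totally real quadratic extension ramified in at most one prime does not acquire 2-torsion in
the class group. -/
theorem noTwoTorsion_of_subsingleton_ramifiedPrimes [IsTotallyReal K] (hd : finrank F K = 2)
    {σ : Gal(K/F)} (hσ : σ ≠ 1) (hram : (ramifiedPrimes (𝓞 F) (𝓞 K)).Subsingleton)
    (hF : NoTwoTorsion (𝓞 F)) : NoTwoTorsion (𝓞 K) := by
  refine (isQuadraticPair_integerConj hd hσ).noTwoTorsion_of_relIndex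
    (two_mul_finrank_fixedUnits_add_one_le hd hσ) hram.finite (fun h0 ↦ ?_) hF
  have h1 : 2 ^ (ramifiedPrimes (𝓞 F) (𝓞 K)).ncard ≤ 2 ^ 1 :=
    Nat.pow_le_pow_right two_pos (by
      have := hram.finite.to_subtype
      exact Set.ncard_le_one_iff_subsingleton.2 hram)
  omega

/-- A totally real quadratic extension ramified in at most two primes, in which some unit is not
a norm, does not acquire 2-torsion in the class group. -/
theorem noTwoTorsion_of_unit_not_norm [IsTotallyReal K] (hd : finrank F K = 2)
    {σ : Gal(K/F)} (hσ : σ ≠ 1) (hfin : (ramifiedPrimes (𝓞 F) (𝓞 K)).Finite)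
    (hram : (ramifiedPrimes (𝓞 F) (𝓞 K)).ncard ≤ 2) (ε : (𝓞 F)ˣ)
    (hε : ∀ (b : K) (a : F), a ≠ 0 → b * σ b ≠ algebraMap F K (((ε : 𝓞 F) : F) * a ^ 2))
    (hF : NoTwoTorsion (𝓞 F)) : NoTwoTorsion (𝓞 K) := by
  refine (isQuadraticPair_integerConj hd hσ).noTwoTorsion_of_relIndex
    (two_mul_finrank_fixedUnits_add_one_le hd hσ) hfin (fun h0 ↦ ?_) hF
  have h1 : 2 ^ (ramifiedPrimes (𝓞 F) (𝓞 K)).ncard ≤ 2 ^ 2 := Nat.pow_le_pow_right two_pos hram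
  have h2 : (IsQuadraticPair.normUnits (𝓞 F) (integerConj σ)).relIndex
      (IsQuadraticPair.fixedUnits (integerConj σ)) ≠ 1 := by
    intro h2
    rw [AddSubgroup.relIndex_eq_one] at h2
    obtain ⟨-, b, a, -, ha, hab⟩ := h2 ((mem_fixedUnits_iff hd hσ
      (x := Additive.ofMul (Units.map (algebraMap (𝓞 F) (𝓞 K) : 𝓞 F →* 𝓞 K) ε))).2 ⟨ε, rfl⟩)
    refine hε b a (RingOfIntegers.coe_ne_zero_iff.2 ha) ?_
    have := congrArg (fun z : 𝓞 K ↦ (z : K)) hab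
    rw [_root_.map_mul, map_pow]
    exact this
  omega

end TotallyReal

section PrimesOverNatPrime

open Ideal Module NumberField

variable {K : Type*} [Field K] [NumberField K] {l : ℕ}

theorem ne_bot_of_natCast_mem (hl : l.Prime) {P : Ideal (𝓞 K)} (h : (l : 𝓞 K) ∈ P) : P ≠ ⊥ := by
  rintro rfl
  exact hl.ne_zero (by exact_mod_cast (Ideal.mem_bot.1 h))

theorem dvd_absNorm_of_natCast_mem (hl : l.Prime) {P : Ideal (𝓞 K)} (hP : P.IsPrime)
    (h : (l : 𝓞 K) ∈ P) : l ∣ absNorm P := by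
  by_contra hdvd
  rw [← hl.coprime_iff_not_dvd] at hdvd
  have h1 : IsCoprime (l : ℤ) (absNorm P : ℤ) := Nat.isCoprime_iff_coprime.2 hdvd
  obtain ⟨a, b, hab⟩ := h1
  apply hP.ne_top
  rw [Ideal.eq_top_iff_one]
  have h2 : (a : 𝓞 K) * l + b * (absNorm P : 𝓞 K) = 1 := by exact_mod_cast congrArg (Int.cast) hab
  rw [← h2]
  exact P.add_mem (P.mul_mem_left _ h) (P.mul_mem_left _ (absNorm_mem P))

theorem absNorm_span_natCast_eq (l : ℕ) :
    absNorm (span {(l : 𝓞 K)}) = l ^ finrank ℚ K := by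
  rw [Ideal.absNorm_span_natCast, RingOfIntegers.rank]

theorem card_le_finrank_of_natCast_mem (hl : l.Prime) (S : Finset (Ideal (𝓞 K)))
    (hS : ∀ P ∈ S, P.IsPrime ∧ (l : 𝓞 K) ∈ P) : S.card ≤ finrank ℚ K := by
  have h1 : ∏ P ∈ S, P ∣ span {(l : 𝓞 K)} := by
    refine Finset.prod_primes_dvd _ (fun P hP ↦ ?_) fun P hP ↦ ?_
    · exact prime_of_isPrime (ne_bot_of_natCast_mem hl (hS P hP).2) (hS P hP).1
    · rw [dvd_iff_le, Ideal.span_singleton_le_iff_mem]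
      exact (hS P hP).2
  have h2 : absNorm (∏ P ∈ S, P) ∣ l ^ finrank ℚ K := by
    rw [← absNorm_span_natCast_eq]
    exact map_dvd absNorm h1
  have h3 : l ^ S.card ∣ absNorm (∏ P ∈ S, P) := by
    rw [map_prod, ← Finset.prod_const]
    exact Finset.prod_dvd_prod_of_dvd _ _ fun P hP ↦
      dvd_absNorm_of_natCast_mem hl (hS P hP).1 (hS P hP).2
  exact (Nat.pow_dvd_pow_iff_le_right hl.one_lt).1 (h3.trans h2)

theorem ncard_le_finrank_of_natCast_mem (hl : l.Prime) :
    {P : Ideal (𝓞 K) | P.IsPrime ∧ (l : 𝓞 K) ∈ P}.Finite ∧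
    {P : Ideal (𝓞 K) | P.IsPrime ∧ (l : 𝓞 K) ∈ P}.ncard ≤ finrank ℚ K := by
  have hfin : {P : Ideal (𝓞 K) | P.IsPrime ∧ (l : 𝓞 K) ∈ P}.Finite := by
    by_contra h
    obtain ⟨S, hS, hcard⟩ := Set.Infinite.exists_subset_card_eq h (finrank ℚ K + 1)
    have := card_le_finrank_of_natCast_mem hl S fun P hP ↦ hS hP
    omega
  refine ⟨hfin, ?_⟩
  rw [Set.ncard_eq_toFinset_card _ hfin]
  exact card_le_finrank_of_natCast_mem hl _ fun P hP ↦ by simpa using hP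

theorem sq_dvd_absNorm (hl : l.Prime) {P : Ideal (𝓞 K)} (hP : P.IsPrime) (h : (l : 𝓞 K) ∈ P)
    {y : 𝓞 K} (hy : ∀ a : ℤ, y - a ∉ P) : l ^ 2 ∣ absNorm P := by
  have h1 : absNorm P ∣ l ^ finrank ℚ K := by
    rw [← absNorm_span_natCast_eq]
    exact map_dvd absNorm (dvd_iff_le.2 ((Ideal.span_singleton_le_iff_mem _).2 h))
  obtain ⟨k, -, hk⟩ := (Nat.dvd_prime_pow hl).1 h1
  rw [hk]
  refine pow_dvd_pow _ ?_
  by_contra! hk2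
  have hk1 : absNorm P ∣ l := by
    rw [hk]
    exact (pow_dvd_pow l (by omega : k ≤ 1)).trans (by rw [pow_one])
  have hPl : absNorm P = l := Nat.dvd_antisymm hk1 (dvd_absNorm_of_natCast_mem hl hP h)
  have : Fact l.Prime := ⟨hl⟩
  have hchar : CharP (𝓞 K ⧸ P) l := by
    refine (CharP.charP_iff_prime_eq_zero hl).2 ?_
    rw [← map_natCast (Ideal.Quotient.mk P), Ideal.Quotient.eq_zero_iff_mem]
    exact h
  have hPb := ne_bot_of_natCast_mem hl h
  have : Finite (𝓞 K ⧸ P) := Ideal.finiteQuotientOfFreeOfNeBot P hPb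
  have hbij : Function.Bijective (ZMod.castHom (dvd_refl l) (𝓞 K ⧸ P)) := by
    rw [Nat.bijective_iff_injective_and_card]
    refine ⟨RingHom.injective _, ?_⟩
    rw [Nat.card_zmod, ← hPl, absNorm_apply, Submodule.cardQuot_apply]
  obtain ⟨a, ha⟩ := hbij.2 (Ideal.Quotient.mk P y)
  obtain ⟨a, rfl⟩ := ZMod.intCast_surjective a
  apply hy a
  rw [← Ideal.Quotient.eq, ← ha, map_intCast, map_intCast]

/-- If the local degree of a prime is at least the global degree, it is the only prime over its
residue characteristic, and the bound on the degree is attained. -/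
theorem eq_of_natCast_mem_pow (hl : l.Prime) {P : Ideal (𝓞 K)} (hP : P.IsPrime) {e f : ℕ}
    (he : (l : 𝓞 K) ∈ P ^ e) (hf : l ^ f ∣ absNorm P) :
    f * e ≤ finrank ℚ K ∧ (finrank ℚ K ≤ f * e →
      ∀ Q : Ideal (𝓞 K), Q.IsPrime → (l : 𝓞 K) ∈ Q → Q = P) := by
  obtain ⟨J, hJ⟩ : P ^ e ∣ span {(l : 𝓞 K)} :=
    dvd_iff_le.2 ((Ideal.span_singleton_le_iff_mem _).2 he)
  have h1 := absNorm_span_natCast_eq (K := K) l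
  rw [hJ, _root_.map_mul, map_pow] at h1
  have h2 : l ^ (f * e) ∣ absNorm P ^ e := by
    rw [pow_mul]
    exact pow_dvd_pow_of_dvd hf e
  have h3 : l ^ (f * e) ∣ l ^ finrank ℚ K := h2.trans ⟨_, h1.symm⟩
  refine ⟨(Nat.pow_dvd_pow_iff_le_right hl.one_lt).1 h3, fun hle Q hQ hlQ ↦ ?_⟩
  have h4 : absNorm J = 1 := by
    have h5 : absNorm P ^ e * absNorm J ∣ absNorm P ^ e := by
      rw [h1]
      exact (pow_dvd_pow l hle).trans h2
    have h6 : absNorm P ^ e ≠ 0 := by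
      intro h0
      rw [h0, zero_mul] at h1
      exact pow_ne_zero _ hl.ne_zero h1.symm
    have h7 := Nat.dvd_antisymm h5 (dvd_mul_right _ _)
    exact Nat.eq_of_mul_eq_mul_left (Nat.pos_of_ne_zero h6) (by rw [h7, mul_one])
  rw [Ideal.absNorm_eq_one_iff.1 h4, Ideal.mul_top] at hJ
  have h5 : P ^ e ≤ Q := by
    rw [← hJ, Ideal.span_singleton_le_iff_mem]
    exact hlQ
  have h6 := hQ.le_of_pow_le h5
  have hP0 : P ≠ ⊥ := by
    rintro rfl
    by_cases he0 : e = 0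
    · rw [he0, pow_zero, Ideal.one_eq_top, top_le_iff] at h5
      exact hQ.ne_top h5
    · rw [bot_pow he0] at he
      exact hl.ne_zero (by exact_mod_cast (Ideal.mem_bot.1 he))
  have hPm : P.IsMaximal := Ring.DimensionLEOne.maximalOfPrime hP0 hP
  exact (hPm.eq_of_le hQ.ne_top h6).symm

end PrimesOverNatPrime

section ClassGroupParity

open Ideal nonZeroDivisors

theorem NoTwoTorsion.of_ringEquiv {R S : Type*} [CommRing R] [CommRing S] (e : R ≃+* S)
    (h : NoTwoTorsion R) : NoTwoTorsion S := by
  intro I b hI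
  obtain ⟨a, ha⟩ := h (I.map (e.symm : S →+* R)) (e.symm b) (by
    rw [← Ideal.map_pow, hI, Ideal.map_span, Set.image_singleton]; rfl)
  refine ⟨e a, ?_⟩
  have h1 := congrArg (Ideal.map (e : R →+* S)) ha
  rw [Ideal.map_map, Ideal.map_span, Set.image_singleton] at h1
  have h2 : (e : R →+* S).comp (e.symm : S →+* R) = RingHom.id S := by
    ext x; simp
  rw [h2, Ideal.map_id] at h1
  exact h1

theorem NoTwoTorsion.odd_card_classGroup {R : Type*} [CommRing R] [IsDedekindDomain R]
    [Finite (ClassGroup R)] (h : NoTwoTorsion R) : Odd (Nat.card (ClassGroup R)) := by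
  rw [← Nat.not_even_iff_odd, even_iff_two_dvd]
  intro h2
  have : Fact (Nat.Prime 2) := ⟨Nat.prime_two⟩
  obtain ⟨c, hc⟩ := exists_prime_orderOf_dvd_card' 2 h2
  obtain ⟨I, rfl⟩ := ClassGroup.mk0_surjective c
  have h3 : ClassGroup.mk0 I ^ 2 = 1 := by rw [← hc, pow_orderOf_eq_one]
  rw [← map_pow, ClassGroup.mk0_eq_one_iff] at h3
  obtain ⟨b, hb⟩ := h3.principal
  obtain ⟨a, ha⟩ := h (I : Ideal R) b (by simpa using hb)
  have h4 : ClassGroup.mk0 I = 1 := (ClassGroup.mk0_eq_one_iff I.2).2 ⟨⟨a, ha⟩⟩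
  rw [h4, orderOf_one] at hc
  omega

theorem sylow_two_eq_bot_of_odd_card {G : Type*} [Group G] (h : Odd (Nat.card G))
    (P : Sylow 2 G) : P.toSubgroup = ⊥ := by
  have : Fact (Nat.Prime 2) := ⟨Nat.prime_two⟩
  have : Finite G := Nat.finite_of_card_ne_zero h.pos.ne'
  rw [← Subgroup.card_eq_one]
  obtain ⟨k, hk⟩ := IsPGroup.iff_card.1 P.isPGroup'
  have h1 := Subgroup.card_subgroup_dvd_card P.toSubgroup
  rcases Nat.eq_zero_or_pos k with rfl | hk0
  · rw [hk, pow_zero]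
  · have h2 : 2 ∣ Nat.card G := (dvd_pow_self 2 hk0.ne').trans (hk ▸ h1)
    exact absurd (even_iff_two_dvd.2 h2) (Nat.not_even_iff_odd.2 h)

end ClassGroupParity

section QuadraticGenerator

open Ideal Module NumberField Polynomial IntermediateField

variable {F K : Type*} [Field F] [Field K] [Algebra F K] {x : K} {d : F}

theorem noTwoTorsion_of_adjoin_eq_top_of_mem (htop : F⟮x⟯ = ⊤) {a : F}
    (ha : algebraMap F K a = x) (hF : NoTwoTorsion (𝓞 F)) : NoTwoTorsion (𝓞 K) := by
  have h1 : (⊥ : IntermediateField F K) = ⊤ := by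
    rw [← htop, eq_comm, IntermediateField.adjoin_simple_eq_bot_iff, IntermediateField.mem_bot]
    exact ⟨a, ha⟩
  have h2 : Function.Surjective (algebraMap F K) := fun b ↦
    IntermediateField.mem_bot.1 (h1 ▸ IntermediateField.mem_top (x := b))
  exact hF.of_ringEquiv (RingOfIntegers.mapRingEquiv
    (RingEquiv.ofBijective (algebraMap F K) ⟨(algebraMap F K).injective, h2⟩))

variable [NumberField K]

theorem eq_of_mem_ramifiedPrimes {P Q : Ideal (𝓞 K)} (hP : P ∈ ramifiedPrimes (𝓞 F) (𝓞 K))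
    (hQ : Q ∈ ramifiedPrimes (𝓞 F) (𝓞 K))
    (h : P.comap (algebraMap (𝓞 F) (𝓞 K)) = Q.comap (algebraMap (𝓞 F) (𝓞 K))) : P = Q := by
  have h1 : P ^ 2 = Q ^ 2 := by rw [← hP.2.2, ← hQ.2.2, h]
  have hPm : P.IsMaximal := Ring.DimensionLEOne.maximalOfPrime hP.2.1 hP.1
  exact hPm.eq_of_le hQ.1.ne_top (hQ.1.le_of_pow_le (h1.trans_le (Ideal.pow_le_self two_ne_zero)))

theorem ramifiedPrimes_finite_of_comap_mem {S : Set (Ideal (𝓞 F))} (hS : S.Finite)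
    (h : ∀ P ∈ ramifiedPrimes (𝓞 F) (𝓞 K), P.comap (algebraMap (𝓞 F) (𝓞 K)) ∈ S) :
    (ramifiedPrimes (𝓞 F) (𝓞 K)).Finite ∧
      (ramifiedPrimes (𝓞 F) (𝓞 K)).ncard ≤ S.ncard := by
  have hinj : Set.InjOn (Ideal.comap (algebraMap (𝓞 F) (𝓞 K)))
      (ramifiedPrimes (𝓞 F) (𝓞 K)) := fun P hP Q hQ hPQ ↦ eq_of_mem_ramifiedPrimes hP hQ hPQ
  exact ⟨Set.Finite.of_finite_image (hS.subset (Set.image_subset_iff.2 h)) hinj,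
    Set.ncard_le_ncard_of_injOn _ h hinj hS⟩

variable [NumberField F]

theorem finrank_le_two_of_adjoin_eq_top (hx : x ^ 2 = algebraMap F K d) (htop : F⟮x⟯ = ⊤) :
    finrank F K ≤ 2 := by
  have hint : IsIntegral F x := Algebra.IsIntegral.isIntegral x
  rw [← IntermediateField.finrank_top', ← htop, IntermediateField.adjoin.finrank hint]
  have h1 : minpoly F x ∣ X ^ 2 - C d := minpoly.dvd F x (by simp [hx])
  have h2 := natDegree_le_of_dvd h1 (X_pow_sub_C_ne_zero two_pos d)
  rwa [natDegree_X_pow_sub_C] at h2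

theorem finrank_eq_two_of_adjoin_eq_top (hx : x ^ 2 = algebraMap F K d)
    (hxF : ∀ a, algebraMap F K a ≠ x) (htop : F⟮x⟯ = ⊤) : finrank F K = 2 := by
  have h1 := finrank_le_two_of_adjoin_eq_top hx htop
  have h2 : finrank F K ≠ 1 := by
    intro h1
    rw [← IntermediateField.finrank_top', ← htop,
      IntermediateField.finrank_adjoin_simple_eq_one_iff] at h1
    obtain ⟨a, ha⟩ := IntermediateField.mem_bot.1 h1
    exact hxF a ha
  have h3 : 0 < finrank F K := finrank_pos
  omega

theorem exists_conj_of_adjoin_eq_top (hx : x ^ 2 = algebraMap F K d)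
    (hxF : ∀ a, algebraMap F K a ≠ x) (htop : F⟮x⟯ = ⊤) :
    ∃ σ : Gal(K/F), σ ≠ 1 ∧ σ x = -x ∧
      ∀ b : K, ∃ u v : F, b * σ b = algebraMap F K (u ^ 2 - d * v ^ 2) := by
  have hd := finrank_eq_two_of_adjoin_eq_top hx hxF htop
  have : Algebra.IsQuadraticExtension F K := ⟨hd⟩
  have h1 := IsGalois.card_aut_eq_finrank F K
  have h2 : 1 < Nat.card Gal(K/F) := by omega
  have := Finite.one_lt_card_iff_nontrivial.1 h2
  obtain ⟨σ, hσ⟩ := exists_ne (1 : Gal(K/F))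
  have hx0 : x ≠ 0 := fun h ↦ hxF 0 (by rw [map_zero, h])
  have hσx : σ x = -x := by
    have h3 : σ x ^ 2 = x ^ 2 := by rw [← map_pow, hx, AlgEquiv.commutes]
    refine (sq_eq_sq_iff_eq_or_eq_neg.1 h3).resolve_left fun h ↦ hxF _
      (exists_of_fixed_of_finrank_eq_two hd hσ h).choose_spec
  refine ⟨σ, hσ, hσx, fun b ↦ ?_⟩
  have hinv := involutive_of_finrank_eq_two hd σ b
  obtain ⟨u, hu⟩ := exists_of_fixed_of_finrank_eq_two hd hσ (x := (b + σ b) / 2) (by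
    rw [map_div₀, map_add, hinv, map_ofNat, add_comm])
  obtain ⟨v, hv⟩ := exists_of_fixed_of_finrank_eq_two hd hσ (x := (b - σ b) / (2 * x)) (by
    simp only [map_div₀, map_sub, hinv, _root_.map_mul, map_ofNat, hσx]
    field_simp
    ring)
  refine ⟨u, v, ?_⟩
  rw [map_sub, _root_.map_mul, map_pow, map_pow, hu, hv, ← hx]
  field_simp
  ring

theorem two_mul_mem_of_mem_ramifiedPrimes (hd : finrank F K = 2) {σ : Gal(K/F)} (hσ : σ ≠ 1)
    {P : Ideal (𝓞 K)} (hP : P ∈ ramifiedPrimes (𝓞 F) (𝓞 K)) {y : 𝓞 K} (hy : σ y = -y) :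
    2 * y ∈ P := by
  have h1 := sub_integerConj_mem hd hσ hP y
  have h2 : integerConj σ y = -y := by
    apply RingOfIntegers.ext
    rw [coe_integerConj, hy]
    rfl
  rwa [h2, sub_neg_eq_add, ← two_mul] at h1

theorem ringHom_eq_of_adjoin_eq_top {F K L : Type*} [Field F] [Field K] [Field L] [Algebra F K]
    {S : Set K} (hS : IntermediateField.adjoin F S = ⊤) {f g : K →+* L}
    (hF : ∀ a, f (algebraMap F K a) = g (algebraMap F K a)) (h : ∀ s ∈ S, f s = g s) : f = g := by
  have h1 : IntermediateField.adjoin F S ≤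
      (RingHom.eqLocusField f g).toIntermediateField (K := F) hF :=
    IntermediateField.adjoin_le_iff.2 h
  ext x
  exact h1 (hS ▸ IntermediateField.mem_top)

end QuadraticGenerator

section TotallyRealGenerators

open NumberField ComplexConjugate

theorem isTotallyReal_of_adjoin_eq_top {K : Type*} [Field K] [NumberField K] {S : Set K}
    (hS : IntermediateField.adjoin ℚ S = ⊤)
    (h : ∀ φ : K →+* ℂ, ∀ s ∈ S, conj (φ s) = φ s) : IsTotallyReal K := by
  refine ⟨fun v ↦ InfinitePlace.isReal_iff.2 ?_⟩
  exact ringHom_eq_of_adjoin_eq_top hS (fun r ↦ by simp) fun s hs ↦ h _ s hs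

theorem conj_eq_of_sq_eq_natCast {z : ℂ} {m : ℕ} (h : z ^ 2 = m) : conj z = z := by
  have h1 : z ^ 2 = ((Real.sqrt m : ℝ) : ℂ) ^ 2 := by
    rw [h, ← Complex.ofReal_pow, Real.sq_sqrt (Nat.cast_nonneg m), Complex.ofReal_natCast]
  rcases sq_eq_sq_iff_eq_or_eq_neg.1 h1 with rfl | rfl
  · exact Complex.conj_ofReal _
  · rw [map_neg, Complex.conj_ofReal]

theorem exists_ofReal_eq_of_iterate_eq_zero {n : ℕ} {z : ℂ}
    (h : (fun t ↦ t ^ 2 - 2)^[n] z = 0) : ∃ r : ℝ, |r| < 2 ∧ z = r := by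
  induction n generalizing z with
  | zero => exact ⟨0, by simp, by simpa using h⟩
  | succ n ih =>
    rw [Function.iterate_succ_apply] at h
    obtain ⟨s, hs, hz⟩ : ∃ s : ℝ, |s| < 2 ∧ z ^ 2 - 2 = s := ih h
    rw [abs_lt] at hs
    have h1 : z ^ 2 = ((Real.sqrt (2 + s) : ℝ) : ℂ) ^ 2 := by
      rw [← Complex.ofReal_pow, Real.sq_sqrt (by linarith), Complex.ofReal_add, ← hz]
      push_cast
      ring
    have h2 : |Real.sqrt (2 + s)| < 2 := by
      rw [abs_of_nonneg (Real.sqrt_nonneg _), Real.sqrt_lt' two_pos]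
      linarith
    rcases sq_eq_sq_iff_eq_or_eq_neg.1 h1 with h3 | h3
    · exact ⟨_, h2, h3⟩
    · exact ⟨-Real.sqrt (2 + s), by rwa [abs_neg], by rw [h3, Complex.ofReal_neg]⟩

end TotallyRealGenerators

section LocalConditions

theorem Padic.isSquare_of_eq_sq_sub {l : ℕ} [Fact l.Prime] {c : ℤ} (hc : ¬ (l : ℤ) ∣ c)
    {x y : ℚ_[l]} (h : (c : ℚ_[l]) = x ^ 2 - l * y ^ 2) : IsSquare (c : ZMod l) := by
  have hl : (l : ℚ_[l]) ≠ 0 := by exact_mod_cast (Fact.out : l.Prime).ne_zero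
  have hc1 : ‖(c : ℚ_[l])‖ = 1 := by
    rw [Padic.norm_intCast_eq_one_iff]
    exact ((Nat.prime_iff_prime_int.1 Fact.out).coprime_iff_not_dvd.2 hc).symm
  have hpar : ∀ w : ℚ_[l], ‖w ^ 2‖ ≠ ‖(l : ℚ_[l]) * y ^ 2‖ ∨ y = 0 := by
    intro w
    by_cases hy : y = 0
    · exact Or.inr hy
    refine Or.inl fun hw ↦ ?_
    have hw0 : w ≠ 0 := by
      rintro rfl
      exact (Fact.out : l.Prime).ne_zero (by simpa [hy] using hw)
    have h1 : (w ^ 2).valuation = ((l : ℚ_[l]) * y ^ 2).valuation := by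
      rw [Padic.norm_eq_zpow_neg_valuation (pow_ne_zero 2 hw0),
        Padic.norm_eq_zpow_neg_valuation (mul_ne_zero hl (pow_ne_zero 2 hy))] at hw
      have h2 : (1 : ℝ) < l := by exact_mod_cast (Fact.out : l.Prime).one_lt
      have := zpow_right_injective₀ (zero_lt_one.trans h2) h2.ne' hw
      simpa using this
    rw [Padic.valuation_mul hl (pow_ne_zero 2 hy), Padic.valuation_pow, Padic.valuation_pow,
      Padic.valuation_natCast, padicValNat_self] at h1
    push_cast at h1
    omega
  have hy1 : ‖(l : ℚ_[l]) * y ^ 2‖ < 1 := by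
    rcases lt_trichotomy ‖(l : ℚ_[l]) * y ^ 2‖ 1 with h1 | h1 | h1
    · exact h1
    · rcases hpar 1 with h2 | h2
      · exact absurd (by rw [h1]; simp) h2
      · simp [h2] at h1
    · have h3 : ‖x ^ 2‖ = ‖(l : ℚ_[l]) * y ^ 2‖ := by
        have h4 : x ^ 2 = (c : ℚ_[l]) + l * y ^ 2 := by rw [h]; ring
        rw [h4, IsUltrametricDist.norm_add_eq_max_of_norm_ne_norm (by rw [hc1]; exact h1.ne),
          hc1, max_eq_right h1.le]
      rcases hpar x with h2 | h2
      · exact absurd h3 h2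
      · norm_num [h2] at h1
  have hx1 : ‖x‖ ≤ 1 := by
    have h4 : x ^ 2 = (c : ℚ_[l]) + l * y ^ 2 := by rw [h]; ring
    have h5 : ‖x ^ 2‖ ≤ 1 := by
      rw [h4]
      exact (Padic.nonarchimedean _ _).trans (max_le hc1.le hy1.le)
    rw [norm_pow] at h5
    exact (pow_le_one_iff_of_nonneg (norm_nonneg _) two_ne_zero).1 h5
  let X : ℤ_[l] := ⟨x, hx1⟩
  let Z : ℤ_[l] := ⟨(l : ℚ_[l]) * y ^ 2, hy1.le⟩
  have h6 : (c : ℤ_[l]) = X ^ 2 - Z := by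
    apply PadicInt.ext
    push_cast
    exact h
  have h7 : PadicInt.toZMod Z = 0 := by
    rw [← RingHom.mem_ker, PadicInt.ker_toZMod, IsLocalRing.mem_maximalIdeal,
      PadicInt.mem_nonunits]
    exact hy1
  have h8 := congrArg PadicInt.toZMod h6
  rw [map_intCast, map_sub, h7, sub_zero, map_pow] at h8
  exact ⟨_, h8.trans (pow_two _)⟩

theorem Padic.isSquare_of_mul_sq_eq {l : ℕ} [Fact l.Prime] {c : ℤ} (hc : ¬ (l : ℤ) ∣ c)
    {a x y : ℚ_[l]} (ha : a ≠ 0) (h : (c : ℚ_[l]) * a ^ 2 = x ^ 2 - l * y ^ 2) :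
    IsSquare (c : ZMod l) := by
  refine Padic.isSquare_of_eq_sq_sub hc (x := x / a) (y := y / a) ?_
  field_simp
  exact h

theorem Padic.exists_sq_eq_intCast {l : ℕ} [Fact l.Prime] (hl2 : l ≠ 2) {c : ℤ}
    (hc : ¬ (l : ℤ) ∣ c) (h : IsSquare (c : ZMod l)) : ∃ s : ℚ_[l], s ^ 2 = c := by
  obtain ⟨a, ha⟩ := h
  obtain ⟨a, rfl⟩ := ZMod.intCast_surjective a
  have h1 : (l : ℤ) ∣ a ^ 2 - c := by
    rw [← ZMod.intCast_zmod_eq_zero_iff_dvd]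
    push_cast
    rw [ha]
    ring
  have hlp := Nat.prime_iff_prime_int.1 (Fact.out : l.Prime)
  have h2 : ¬ (l : ℤ) ∣ 2 * a := by
    intro h3
    rcases hlp.dvd_or_dvd h3 with h3 | h3
    · exact hl2 ((Nat.prime_dvd_prime_iff_eq Fact.out Nat.prime_two).1 (by exact_mod_cast h3))
    · exact hc ((dvd_sub_right (dvd_pow h3 two_ne_zero)).1 h1)
  obtain ⟨z, hz, -⟩ := hensels_lemma (p := l)
    (F := Polynomial.X ^ 2 - Polynomial.C (c : ℤ_[l])) (a := (a : ℤ_[l])) (by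
      have h3 : ‖((2 * a : ℤ) : ℤ_[l])‖ = 1 := by
        refine le_antisymm (PadicInt.norm_le_one _) (not_lt.1 fun h4 ↦ h2 ?_)
        exact (PadicInt.norm_intCast_lt_one_iff).1 h4
      have h4 : ‖((a ^ 2 - c : ℤ) : ℤ_[l])‖ < 1 := PadicInt.norm_intCast_lt_one_iff.2 h1
      push_cast at h3 h4
      simpa [h3, one_add_one_eq_two] using h4)
  refine ⟨z, ?_⟩
  have h5 : z ^ 2 = c := by simpa [sub_eq_zero] using hz
  exact_mod_cast congrArg (fun t : ℤ_[l] ↦ (t : ℚ_[l])) h5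

end LocalConditions

section QuadraticAndBiquadratic

open Ideal Module NumberField IntermediateField

theorem noTwoTorsion_ringOfIntegers_rat : NoTwoTorsion (𝓞 ℚ) := by
  intro I b _
  have : IsPrincipalIdealRing (𝓞 ℚ) :=
    IsPrincipalIdealRing.of_surjective (Rat.ringOfIntegersEquiv.symm : ℤ →+* 𝓞 ℚ)
      Rat.ringOfIntegersEquiv.symm.surjective
  exact (IsPrincipalIdealRing.principal I).principal

theorem exists_ringOfIntegers_sq_sub_eq {K : Type*} [Field K] {x : K} {a b : ℤ}
    (hx : x ^ 2 - a * x = b) : ∃ y : 𝓞 K, (y : K) = x ∧ y ^ 2 - a * y = b := by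
  have hx' : IsIntegral ℤ x := by
    refine ⟨Polynomial.X ^ 2 - Polynomial.C a * Polynomial.X - Polynomial.C b, ?_, ?_⟩
    · monicity!
    · simp only [Polynomial.eval₂_sub, Polynomial.eval₂_mul, Polynomial.eval₂_pow,
        Polynomial.eval₂_X, Polynomial.eval₂_C]
      simp [hx]
  obtain ⟨y, rfl⟩ : ∃ y : 𝓞 K, (y : K) = x := ⟨⟨x, hx'⟩, rfl⟩
  exact ⟨y, rfl, RingOfIntegers.coe_injective (by
    rw [map_sub, _root_.map_mul, map_pow, map_intCast, map_intCast, hx])⟩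

theorem exists_ringOfIntegers_sq_eq {K : Type*} [Field K] {x : K} {m : ℤ}
    (hx : x ^ 2 = m) : ∃ y : 𝓞 K, (y : K) = x ∧ y ^ 2 = m := by
  simpa using exists_ringOfIntegers_sq_sub_eq (a := 0) (b := m) (by simpa using hx)

theorem intCast_mem_iff_dvd {R : Type*} [CommRing R] {P : Ideal R} (hP : P ≠ ⊤) {l : ℕ}
    (hl : l.Prime) (h : (l : R) ∈ P) {a : ℤ} : (a : R) ∈ P ↔ (l : ℤ) ∣ a := by
  refine ⟨fun ha ↦ ?_, fun ⟨k, hk⟩ ↦ ?_⟩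
  · by_contra hdvd
    obtain ⟨u, v, huv⟩ := (Nat.prime_iff_prime_int.1 hl).coprime_iff_not_dvd.2 hdvd
    refine hP ((Ideal.eq_top_iff_one _).2 ?_)
    have h1 : (u : R) * l + v * a = 1 := by exact_mod_cast congrArg (Int.cast (R := R)) huv
    rw [← h1]
    exact P.add_mem (P.mul_mem_left _ h) (P.mul_mem_left _ ha)
  · rw [hk]
    push_cast
    exact P.mul_mem_right _ h

/-- `ℚ(√q)` has no 2-torsion in its class group when `q ≡ 3 mod 4`. -/
theorem noTwoTorsion_quadratic {K : Type*} [Field K] [NumberField K] {q : ℕ}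
    (hqp : q.Prime) (hq : q % 4 = 3) {y : K} (hy : y ^ 2 = q) (htop : ℚ⟮y⟯ = ⊤) :
    NoTwoTorsion (𝓞 K) := by
  have hy' : y ^ 2 = algebraMap ℚ K q := by rw [hy, map_natCast]
  by_cases hyQ : ∃ a : ℚ, algebraMap ℚ K a = y
  · obtain ⟨a, ha⟩ := hyQ
    exact noTwoTorsion_of_adjoin_eq_top_of_mem htop ha noTwoTorsion_ringOfIntegers_rat
  push Not at hyQ
  have hd := finrank_eq_two_of_adjoin_eq_top hy' hyQ htop
  obtain ⟨σ, hσ, hσy, hnorm⟩ := exists_conj_of_adjoin_eq_top hy' hyQ htop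
  have : IsTotallyReal K := isTotallyReal_of_adjoin_eq_top htop fun φ s hs ↦ by
    rw [Set.mem_singleton_iff.1 hs]
    exact conj_eq_of_sq_eq_natCast (m := q) (by rw [← map_pow, hy, map_natCast])
  obtain ⟨Y, hYy, hY⟩ := exists_ringOfIntegers_sq_eq (m := q) (by rw [hy, Int.cast_natCast])
  have hram : ∀ P ∈ ramifiedPrimes (𝓞 ℚ) (𝓞 K), P.comap (algebraMap (𝓞 ℚ) (𝓞 K)) ∈
      {P : Ideal (𝓞 ℚ) | P.IsPrime ∧ ((2 : ℕ) : 𝓞 ℚ) ∈ P} ∪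
      {P : Ideal (𝓞 ℚ) | P.IsPrime ∧ (q : 𝓞 ℚ) ∈ P} := by
    intro P hP
    have hPp := hP.1
    have h1 := two_mul_mem_of_mem_ramifiedPrimes hd hσ hP (y := Y) (by rw [hYy, hσy])
    rcases hP.1.mem_or_mem h1 with h2 | h2
    · exact Or.inl ⟨inferInstance, by rwa [Ideal.mem_comap, map_natCast, Nat.cast_ofNat]⟩
    · refine Or.inr ⟨inferInstance, ?_⟩
      have h3 : Y ^ 2 ∈ P := P.pow_mem_of_mem h2 2 two_pos
      rw [hY] at h3
      simpa using h3
  have h2 := ncard_le_finrank_of_natCast_mem (K := ℚ) Nat.prime_two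
  have h3 := ncard_le_finrank_of_natCast_mem (K := ℚ) hqp
  rw [finrank_self] at h2 h3
  obtain ⟨hfin, hcard⟩ := ramifiedPrimes_finite_of_comap_mem (h2.1.union h3.1) hram
  refine noTwoTorsion_of_unit_not_norm hd hσ hfin (hcard.trans ?_) (-1) ?_
    noTwoTorsion_ringOfIntegers_rat
  · exact (Set.ncard_union_le _ _).trans (by omega)
  intro b a ha hb
  obtain ⟨u, v, huv⟩ := hnorm b
  rw [huv] at hb
  have h4 := (algebraMap ℚ K).injective hb
  have : Fact q.Prime := ⟨hqp⟩
  have h5 : IsSquare ((-1 : ℤ) : ZMod q) := by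
    refine Padic.isSquare_of_mul_sq_eq (a := (a : ℚ_[q])) (x := (u : ℚ_[q])) (y := (v : ℚ_[q]))
      ?_ (by exact_mod_cast ha) ?_
    · rw [dvd_neg]
      exact (Nat.prime_iff_prime_int.1 hqp).not_dvd_one
    · have h6 : (-1 : ℚ) * a ^ 2 = u ^ 2 - q * v ^ 2 := by simpa using h4.symm
      exact_mod_cast congrArg (Rat.cast (K := ℚ_[q])) h6
  rw [Int.cast_neg, Int.cast_one] at h5
  obtain ⟨c, hc⟩ := h5
  exact ZMod.mod_four_ne_three_of_sq_eq_neg_one (by rw [hc, pow_two]) hq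

/-- The prime of `ℚ(√q)` over 2, for `q ≡ 3 mod 8`, gives a unit which differs from 2 by a
square. -/
theorem exists_unit_mul_sq_eq_two {R : Type*} [CommRing R] [IsDomain R] (hR : NoTwoTorsion R)
    {Y : R} {m : ℤ} (hY : Y ^ 2 = ((8 * m + 3 : ℤ) : R)) : ∃ (ε : Rˣ) (β : R), ε * β ^ 2 = 2 := by
  have h1 : (span {2, 1 + Y} : Ideal R) ^ 2 = span {2} := by
    apply le_antisymm
    · rw [pow_two, Ideal.span_pair_mul_span_pair, Ideal.span_le]
      push_cast at hY
      rintro z (rfl | rfl | rfl | rfl)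
      · exact Ideal.mem_span_singleton.2 ⟨2, rfl⟩
      · exact Ideal.mem_span_singleton.2 ⟨_, rfl⟩
      · exact Ideal.mem_span_singleton.2 ⟨_, mul_comm _ _⟩
      · exact Ideal.mem_span_singleton.2 ⟨4 * m + 2 + Y, by linear_combination hY⟩
    · rw [Ideal.span_singleton_le_iff_mem, pow_two]
      have ha : (2 : R) ∈ (span {2, 1 + Y} : Ideal R) := Ideal.subset_span (by simp)
      have hb : 1 + Y ∈ (span {2, 1 + Y} : Ideal R) := Ideal.subset_span (by simp)
      have h2 : (2 : R) = (1 + Y) * (1 + Y) - 2 * (1 + Y) - (2 * 2) * (2 * m) := by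
        push_cast at hY
        linear_combination -hY
      have h3 := sub_mem (sub_mem (Ideal.mul_mem_mul hb hb) (Ideal.mul_mem_mul ha hb))
        (Ideal.mul_mem_right (2 * m : R) _ (Ideal.mul_mem_mul ha ha))
      rwa [← h2] at h3
  obtain ⟨β, hβ⟩ := hR _ _ h1
  rw [hβ, Ideal.span_singleton_pow, Ideal.span_singleton_eq_span_singleton] at h1
  obtain ⟨ε, hε⟩ := h1
  exact ⟨ε, β, by rw [mul_comm, hε]⟩

theorem ZMod.not_isSquare_two_of_mod_eight {p : ℕ} [Fact p.Prime] (hp : p % 8 = 5) :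
    ¬ IsSquare (2 : ZMod p) := by
  rw [ZMod.exists_sq_eq_two_iff (by omega)]
  omega

/-- `ℚ(√p, √q)` has no 2-torsion in its class group when `p ≡ 5 mod 8` and `q ≡ 3 mod 8`. -/
theorem noTwoTorsion_biquadratic {F K : Type*} [Field F] [Field K] [NumberField F] [NumberField K]
    [Algebra F K] [IsTotallyReal K] {p q : ℕ} (hpp : p.Prime) (hqp : q.Prime) (hp : p % 8 = 5)
    (hq : q % 8 = 3) {y : F} (hy : y ^ 2 = q) (hytop : ℚ⟮y⟯ = ⊤) {x : K} (hx : x ^ 2 = p)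
    (hxtop : F⟮x⟯ = ⊤) : NoTwoTorsion (𝓞 K) := by
  have hF := noTwoTorsion_quadratic hqp (by omega) hy hytop
  have hx' : x ^ 2 = algebraMap F K p := by rw [hx, map_natCast]
  by_cases hxF : ∃ a, algebraMap F K a = x
  · obtain ⟨a, ha⟩ := hxF
    exact noTwoTorsion_of_adjoin_eq_top_of_mem hxtop ha hF
  push Not at hxF
  have hd := finrank_eq_two_of_adjoin_eq_top hx' hxF hxtop
  obtain ⟨σ, hσ, hσx, hnorm⟩ := exists_conj_of_adjoin_eq_top hx' hxF hxtop
  have hF2 : finrank ℚ F ≤ 2 :=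
    finrank_le_two_of_adjoin_eq_top (d := (q : ℚ)) (by rw [hy, map_natCast]) hytop
  have := Fact.mk hpp
  have hqp' : ¬ (p : ℤ) ∣ q := by
    intro h
    have := (Nat.prime_dvd_prime_iff_eq hpp hqp).1 (by exact_mod_cast h)
    omega
  obtain ⟨j, hj⟩ : ∃ j : ℕ, p = 8 * j + 5 := ⟨p / 8, by omega⟩
  obtain ⟨m, hm⟩ : ∃ m : ℕ, q = 8 * m + 3 := ⟨q / 8, by omega⟩
  obtain ⟨Y, hYy, hY⟩ := exists_ringOfIntegers_sq_eq (m := q) (by rw [hy, Int.cast_natCast])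
  obtain ⟨W, hWx, -⟩ := exists_ringOfIntegers_sq_sub_eq (x := (1 + x) / 2) (a := 1)
    (b := 2 * j + 1) (by
      rw [hj] at hx
      push_cast at hx ⊢
      linear_combination hx / 4)
  have hram : ∀ P ∈ ramifiedPrimes (𝓞 F) (𝓞 K), P.comap (algebraMap (𝓞 F) (𝓞 K)) ∈
      {P : Ideal (𝓞 F) | P.IsPrime ∧ (p : 𝓞 F) ∈ P} := by
    intro P hP
    have hPp := hP.1
    refine ⟨inferInstance, ?_⟩
    have h1 := P.pow_mem_of_mem (sub_integerConj_mem hd hσ hP W) 2 two_pos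
    have h2 : (W - integerConj σ W) ^ 2 = p := by
      apply RingOfIntegers.coe_injective
      have h3 : algebraMap (𝓞 K) K (integerConj σ W) = σ (algebraMap (𝓞 K) K W) := rfl
      have h4 : algebraMap (𝓞 K) K W = (1 + x) / 2 := hWx
      rw [map_pow, map_sub, h3, h4, map_natCast, ← hx, map_div₀, map_add, map_one,
        hσx, map_ofNat]
      ring
    rw [h2] at h1
    rwa [Ideal.mem_comap, map_natCast]
  have h3 := ncard_le_finrank_of_natCast_mem (K := F) hpp
  by_cases hsq : IsSquare ((q : ℤ) : ZMod p)
  · obtain ⟨hfin, hcard⟩ := ramifiedPrimes_finite_of_comap_mem h3.1 hram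
    obtain ⟨ε, β, hε⟩ := exists_unit_mul_sq_eq_two hF (Y := Y) (m := m) (by
      rw [hY, hm]
      push_cast
      rfl)
    refine noTwoTorsion_of_unit_not_norm hd hσ hfin (hcard.trans (h3.2.trans hF2)) ε ?_ hF
    intro b a ha hb
    obtain ⟨u, v, huv⟩ := hnorm b
    rw [huv] at hb
    have h4 := (algebraMap F K).injective hb
    obtain ⟨s, hs⟩ := Padic.exists_sq_eq_intCast (by omega) hqp' hsq
    obtain ⟨φ⟩ : Nonempty (F →ₐ[ℚ] ℚ_[p]) := by
      refine nonempty_algHom_of_adjoin_splits (fun t ht ↦ ?_) hytop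
      rw [Set.mem_singleton_iff.1 ht]
      refine ⟨Algebra.IsIntegral.isIntegral y, ?_⟩
      have h5 : minpoly ℚ y ∣ Polynomial.X ^ 2 - Polynomial.C (q : ℚ) :=
        minpoly.dvd ℚ y (by simp [hy])
      have h6 : (Polynomial.X ^ 2 - Polynomial.C (q : ℚ)).map (algebraMap ℚ ℚ_[p]) =
          (Polynomial.X - Polynomial.C s) * (Polynomial.X + Polynomial.C s) := by
        rw [Int.cast_natCast] at hs
        rw [Polynomial.map_sub, Polynomial.map_pow, Polynomial.map_X, Polynomial.map_C,
          map_natCast, ← hs, Polynomial.C_pow]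
        ring
      have h7 : ((Polynomial.X ^ 2 - Polynomial.C (q : ℚ)).map (algebraMap ℚ ℚ_[p])).Splits := by
        rw [h6]
        exact (Polynomial.Splits.X_sub_C s).mul (Polynomial.Splits.X_add_C s)
      refine h7.of_dvd ?_ (Polynomial.map_dvd _ h5)
      exact (Polynomial.map_ne_zero_iff (algebraMap ℚ ℚ_[p]).injective).2
        (Polynomial.X_pow_sub_C_ne_zero two_pos _)
    have h7 : IsSquare ((2 : ℤ) : ZMod p) := by
      have hβ : (((ε : 𝓞 F) : F) * (β : F) ^ 2) = 2 := by
        have h8 := congrArg (algebraMap (𝓞 F) F) hε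
        rwa [_root_.map_mul, map_pow, map_ofNat] at h8
      refine Padic.isSquare_of_mul_sq_eq (a := φ a) (x := φ (β * u)) (y := φ (β * v)) ?_
        (by rwa [map_ne_zero]) ?_
      · intro h
        have := Int.le_of_dvd two_pos h
        omega
      · have h8 : (2 : F) * a ^ 2 = (β * u) ^ 2 - p * (β * v) ^ 2 := by
          linear_combination (β : F) ^ 2 * (-h4) - a ^ 2 * hβ
        have h9 := congrArg φ h8
        rw [_root_.map_mul, map_sub, _root_.map_mul, map_pow, map_pow, map_pow, map_natCast,
          map_ofNat] at h9
        exact_mod_cast h9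
    exact ZMod.not_isSquare_two_of_mod_eight hp (by exact_mod_cast h7)
  · refine noTwoTorsion_of_subsingleton_ramifiedPrimes hd hσ (fun P hP Q hQ ↦ ?_) hF
    apply eq_of_mem_ramifiedPrimes hP hQ
    obtain ⟨hPp, hPm⟩ := hram P hP
    obtain ⟨hQp, hQm⟩ := hram Q hQ
    have h4 : ∀ a : ℤ, Y - a ∉ P.comap (algebraMap (𝓞 F) (𝓞 K)) := by
      intro a ha
      have h5 : (((q : ℤ) - a ^ 2 : ℤ) : 𝓞 F) ∈ P.comap (algebraMap (𝓞 F) (𝓞 K)) := by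
        have h6 : (((q : ℤ) - a ^ 2 : ℤ) : 𝓞 F) = (Y + a) * (Y - a) := by
          push_cast at hY ⊢
          linear_combination -hY
        rw [h6]
        exact Ideal.mul_mem_left _ _ ha
      rw [intCast_mem_iff_dvd hPp.ne_top hpp hPm, ← ZMod.intCast_zmod_eq_zero_iff_dvd] at h5
      refine hsq ⟨a, ?_⟩
      push_cast at h5 ⊢
      linear_combination h5
    have h5 := sq_dvd_absNorm hpp hPp hPm h4
    exact ((eq_of_natCast_mem_pow hpp hPp (e := 1) (by rwa [pow_one]) h5).2 hF2 _ hQp hQm).symm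

end QuadraticAndBiquadratic

section PrimesOverTwo

open Ideal Module NumberField IntermediateField

/-- There is at most one prime over 2. -/
def AtMostOnePrimeOverTwo (R : Type*) [CommRing R] : Prop :=
  {P : Ideal R | P.IsPrime ∧ (2 : R) ∈ P}.Subsingleton

theorem two_mem_pow_four {R : Type*} [CommRing R] [IsDedekindDomain R] {P : Ideal R}
    (hP : P.IsPrime) (h2 : (2 : R) ∈ P) {r s : R} {m : ℤ} (hr : r ^ 2 = 2)
    (hs : s ^ 2 - r * s = ((4 * m + 1 : ℤ) : R)) : (2 : R) ∈ P ^ 4 := by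
  have hr1 : r ∈ P := hP.mem_of_pow_mem 2 (hr ▸ h2)
  have hsP : s ∉ P := by
    intro h
    have h3 : (((4 * m + 1 : ℤ) : R)) ∈ P := by
      rw [← hs]
      exact P.sub_mem (P.pow_mem_of_mem h 2 two_pos) (P.mul_mem_left _ h)
    rw [intCast_mem_iff_dvd hP.ne_top Nat.prime_two (by simpa using h2)] at h3
    push_cast at h3
    omega
  push_cast at hs
  have hfac : (s - 1) ^ 2 = r * (s + r * (2 * m + 1 - s)) := by
    linear_combination hs - (2 * m + 1 - s) * hr
  have h1 : s - 1 ∈ P := by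
    refine hP.mem_of_pow_mem 2 ?_
    rw [hfac]
    exact P.mul_mem_right _ hr1
  have h3 : r * (s + r * (2 * m + 1 - s)) ∈ P ^ 2 := by
    rw [← hfac]
    exact Ideal.pow_mem_pow h1 2
  have h4 : s + r * (2 * m + 1 - s) ∉ P := fun h ↦
    hsP ((P.add_mem_iff_left (P.mul_mem_right _ hr1)).1 h)
  have h5 : r ∈ P ^ 2 := (hP.mul_mem_pow _ (by rwa [mul_comm] at h3)).resolve_left h4
  rw [← hr, show 4 = 2 * 2 from rfl, pow_mul]
  exact Ideal.pow_mem_pow h5 2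

theorem le_finrank_of_sqrt_mem {K : Type*} [Field K] [NumberField K] {p q : ℕ} (hp : p % 8 = 5)
    (hq : q % 8 = 3) {r x y : K} (hr : r ^ 2 = 2) (hx : x ^ 2 = p) (hy : y ^ 2 = q) :
    8 ≤ finrank ℚ K ∧ (finrank ℚ K ≤ 8 → AtMostOnePrimeOverTwo (𝓞 K)) := by
  obtain ⟨j, hj⟩ : ∃ j : ℕ, p = 8 * j + 5 := ⟨p / 8, by omega⟩
  obtain ⟨m, hm⟩ : ∃ m : ℕ, q = 8 * m + 3 := ⟨q / 8, by omega⟩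
  obtain ⟨R, hRr, hR⟩ := exists_ringOfIntegers_sq_eq (x := r) (m := 2) (by simpa using hr)
  obtain ⟨W, -, hW⟩ := exists_ringOfIntegers_sq_sub_eq (x := (1 + x) / 2) (a := 1)
    (b := 2 * j + 1) (by
      rw [hj] at hx
      push_cast at hx ⊢
      linear_combination hx / 4)
  have hr0 : r ≠ 0 := by
    rintro rfl
    simp at hr
  rw [hm] at hy
  push_cast at hy
  have hs : ((1 + y) / r) ^ 2 - r * ((1 + y) / r) = (4 * m + 1 : ℤ) := by
    push_cast
    rw [mul_div_cancel₀ _ hr0, div_pow, hr]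
    linear_combination hy / 2
  have hsi : IsIntegral ℤ ((1 + y) / r) := by
    have h1 : ((1 + y) / r) ^ 2 = ((4 * m + 2 : ℤ) : K) + y := by
      push_cast at hs ⊢
      rw [mul_div_cancel₀ _ hr0] at hs
      linear_combination hs
    refine IsIntegral.of_pow two_pos ?_
    rw [h1]
    refine (isIntegral_algebraMap (R := ℤ) (A := K) (x := 4 * m + 2)).add ?_
    refine IsIntegral.of_pow two_pos ?_
    rw [hy]
    exact_mod_cast isIntegral_algebraMap (R := ℤ) (A := K) (x := 8 * m + 3)
  obtain ⟨S, hS⟩ : ∃ S : 𝓞 K, (S : K) = (1 + y) / r := ⟨⟨_, hsi⟩, rfl⟩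
  have hS2 : S ^ 2 - R * S = ((4 * m + 1 : ℤ) : 𝓞 K) := by
    apply RingOfIntegers.coe_injective
    have h1 : algebraMap (𝓞 K) K R = r := hRr
    have h2 : algebraMap (𝓞 K) K S = _ := hS
    rw [map_sub, _root_.map_mul, map_pow, h1, h2, hs, map_intCast]
  have key : ∀ P : Ideal (𝓞 K), P.IsPrime → (2 : 𝓞 K) ∈ P → 2 * 4 ≤ finrank ℚ K ∧
      (finrank ℚ K ≤ 2 * 4 → ∀ Q : Ideal (𝓞 K), Q.IsPrime → ((2 : ℕ) : 𝓞 K) ∈ Q → Q = P) := by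
    intro P hP h2
    have h2' : ((2 : ℕ) : 𝓞 K) ∈ P := by rwa [Nat.cast_ofNat]
    refine eq_of_natCast_mem_pow Nat.prime_two hP ?_ (sq_dvd_absNorm Nat.prime_two hP h2'
      (y := W) fun a ha ↦ ?_)
    · rw [Nat.cast_ofNat]
      exact two_mem_pow_four hP h2 (by simpa using hR) hS2
    · have h3 : ((2 * j + 1 - a ^ 2 + a : ℤ) : 𝓞 K) ∈ P := by
        have h4 : ((2 * j + 1 - a ^ 2 + a : ℤ) : 𝓞 K) = (W + a - 1) * (W - a) := by
          push_cast at hW ⊢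
          linear_combination -hW
        rw [h4]
        exact P.mul_mem_left _ ha
      rw [intCast_mem_iff_dvd hP.ne_top Nat.prime_two h2'] at h3
      have h5 : Even (a * (a - 1)) := Int.even_mul_pred_self a
      obtain ⟨b, hb⟩ := h3
      obtain ⟨c, hc⟩ := h5
      push_cast at hb
      have h6 : 2 * j + 1 = 2 * b + 2 * c := by linear_combination hb + hc
      omega
  refine ⟨?_, fun h8 P hP Q hQ ↦ ?_⟩
  · obtain ⟨P, hP, hle⟩ := Ideal.exists_le_maximal (span {(2 : 𝓞 K)}) (by
      rw [Ne, Ideal.span_singleton_eq_top]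
      intro h
      have h1 := absNorm_span_natCast_eq (K := K) 2
      rw [Nat.cast_ofNat, Ideal.span_singleton_eq_top.2 h, Ideal.absNorm_top] at h1
      exact (Nat.one_lt_two_pow finrank_pos.ne').ne h1)
    exact (key P hP.isPrime ((Ideal.span_singleton_le_iff_mem _).1 hle)).1
  · exact ((key P hP.1 hP.2).2 h8 Q hQ.1 (by simpa using hQ.2)).symm

/-- The first layer: adjoining `√2` to `ℚ(√p, √q)`. -/
theorem noTwoTorsion_adjoin_sqrt_two {F K : Type*} [Field F] [Field K] [NumberField F]
    [NumberField K] [Algebra F K] [IsTotallyReal K] (hF : NoTwoTorsion (𝓞 F))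
    (hF4 : finrank ℚ F ≤ 4) {p q : ℕ} (hp : p % 8 = 5) (hq : q % 8 = 3) {x y : F}
    (hx : x ^ 2 = p) (hy : y ^ 2 = q) {r : K} (hr : r ^ 2 = 2) (htop : F⟮r⟯ = ⊤) :
    (∀ a, algebraMap F K a ≠ r) ∧ AtMostOnePrimeOverTwo (𝓞 K) ∧ NoTwoTorsion (𝓞 K) := by
  have hrF : ∀ a, algebraMap F K a ≠ r := by
    rintro a rfl
    have := (le_finrank_of_sqrt_mem hp hq (r := a) ((algebraMap F K).injective
      (by rw [map_pow, hr, map_ofNat])) hx hy).1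
    omega
  have hr' : r ^ 2 = algebraMap F K 2 := by rw [hr, map_ofNat]
  have hd := finrank_eq_two_of_adjoin_eq_top hr' hrF htop
  obtain ⟨σ, hσ, hσr, -⟩ := exists_conj_of_adjoin_eq_top hr' hrF htop
  have hK8 : finrank ℚ K ≤ 8 := by
    rw [← Module.finrank_mul_finrank ℚ F K, hd]
    omega
  have huniq := (le_finrank_of_sqrt_mem hp hq (x := algebraMap F K x) (y := algebraMap F K y) hr
    (by rw [← map_pow, hx, map_natCast]) (by rw [← map_pow, hy, map_natCast])).2 hK8
  refine ⟨hrF, huniq, noTwoTorsion_of_subsingleton_ramifiedPrimes hd hσ ?_ hF⟩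
  obtain ⟨R, hRr, hR⟩ := exists_ringOfIntegers_sq_eq (x := r) (m := 2) (by simpa using hr)
  have h2 : ∀ P ∈ ramifiedPrimes (𝓞 F) (𝓞 K), (2 : 𝓞 K) ∈ P := by
    intro P hP
    have h1 := two_mul_mem_of_mem_ramifiedPrimes hd hσ hP (y := R) (by rw [hRr, hσr])
    refine (hP.1.mem_or_mem h1).elim id fun h2 ↦ ?_
    have h3 := P.pow_mem_of_mem h2 2 two_pos
    rw [hR] at h3
    simpa using h3
  exact fun P hP Q hQ ↦ huniq ⟨hP.1, h2 P hP⟩ ⟨hQ.1, h2 Q hQ⟩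

/-- A quadratic extension inherits uniqueness of the prime over 2 when its conjugation is a
square. -/
theorem atMostOnePrimeOverTwo_of_conj_eq_sq {F K : Type*} [Field F] [Field K] [NumberField F]
    [NumberField K] [Algebra F K] (hd : finrank F K = 2) {σ : Gal(K/F)} (hσ : σ ≠ 1)
    (T : K →+* K) (hT : ∀ b, T (T b) = σ b) (hF : AtMostOnePrimeOverTwo (𝓞 F)) :
    AtMostOnePrimeOverTwo (𝓞 K) := by
  intro P hP Q hQ
  have hmax : ∀ P : Ideal (𝓞 K), P.IsPrime → (2 : 𝓞 K) ∈ P → P.IsMaximal := fun P hP h2 ↦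
    Ring.DimensionLEOne.maximalOfPrime
      (ne_bot_of_natCast_mem Nat.prime_two (by simpa using h2)) hP
  have hunder : ∀ P Q : Ideal (𝓞 K), P.IsPrime → (2 : 𝓞 K) ∈ P → Q.IsPrime → (2 : 𝓞 K) ∈ Q →
      Q.under (𝓞 F) = P.under (𝓞 F) := by
    intro P Q hP hP2 hQ hQ2
    refine hF ⟨inferInstance, ?_⟩ ⟨inferInstance, ?_⟩ <;>
      rwa [Ideal.under_def, Ideal.mem_comap, map_ofNat]
  have hor : ∀ P Q : Ideal (𝓞 K), P.IsPrime → (2 : 𝓞 K) ∈ P → Q.IsPrime → (2 : 𝓞 K) ∈ Q →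
      P = Q ∨ ∀ z, z ∈ Q ↔ integerConj σ z ∈ P := by
    intro P Q hP hP2 hQ hQ2
    refine or_iff_not_imp_left.2 fun hne z ↦ ?_
    have hle := le_map_of_under_eq hd hσ hP (hmax Q hQ hQ2) (hunder P Q hP hP2 hQ hQ2) hne
    have hne' : P.map (integerConj σ) ≠ ⊤ :=
      ((isQuadraticPair_integerConj hd hσ).map_isPrime hP).ne_top
    rw [(hmax Q hQ hQ2).eq_of_le hne' hle, mem_map_integerConj hd σ]
  let t : 𝓞 K →+* 𝓞 K := RingOfIntegers.mapRingHom T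
  have ht : ∀ z, t (t z) = integerConj σ z := fun z ↦ RingOfIntegers.coe_injective (hT z)
  have hself : ∀ P : Ideal (𝓞 K), P.IsPrime → (2 : 𝓞 K) ∈ P → ∀ z, z ∈ P ↔ integerConj σ z ∈ P := by
    intro P hP hP2 z
    rcases hor P (P.comap t) hP hP2 inferInstance (by rwa [Ideal.mem_comap, map_ofNat]) with h | h
    · have h1 : ∀ z, z ∈ P ↔ t z ∈ P := fun z ↦ by
        conv_lhs => rw [h]
        rfl
      rw [h1, h1, ht]
    · have h1 : ∀ z, t z ∈ P ↔ t (t z) ∈ P := fun z ↦ by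
        rw [ht, ← h]
        rfl
      have h2 : t (t (t (t z))) = z := by
        rw [ht, ht]
        exact RingOfIntegers.coe_injective (involutive_of_finrank_eq_two hd σ z)
      conv_lhs => rw [← h2]
      rw [← ht, ← h1 (t (t z)), h1 (t z)]
  rcases hor P Q hP.1 hP.2 hQ.1 hQ.2 with h | h
  · exact h
  · ext z
    rw [h, hself P hP.1 hP.2]

/-- The inductive step along the cyclotomic tower. -/
theorem noTwoTorsion_of_sq_conj {F K : Type*} [Field F] [Field K] [NumberField F] [NumberField K]
    [Algebra F K] [IsTotallyReal K] (hF : NoTwoTorsion (𝓞 F)) (hF2 : AtMostOnePrimeOverTwo (𝓞 F))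
    {x : 𝓞 K} {d : F} (hx : (x : K) ^ 2 = algebraMap F K d) (htop : F⟮(x : K)⟯ = ⊤)
    (hx2 : ∀ P : Ideal (𝓞 K), P.IsPrime → x ∈ P → (2 : 𝓞 K) ∈ P) {T : K →+* K}
    (hTF : ∀ a, T (T (algebraMap F K a)) = algebraMap F K a) (hTx : T (T x) = -x) (hx0 : x ≠ 0) :
    NoTwoTorsion (𝓞 K) ∧ AtMostOnePrimeOverTwo (𝓞 K) := by
  have hx0' : (x : K) ≠ 0 := by simpa using hx0
  have hxF : ∀ a, algebraMap F K a ≠ x := by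
    intro a ha
    rw [← ha, hTF, ha, eq_comm, neg_eq_self] at hTx
    exact hx0' hTx
  have hd := finrank_eq_two_of_adjoin_eq_top hx hxF htop
  obtain ⟨σ, hσ, hσx, -⟩ := exists_conj_of_adjoin_eq_top hx hxF htop
  have hT : T.comp T = (σ : K →+* K) := ringHom_eq_of_adjoin_eq_top htop
    (fun a ↦ by simpa using hTF a) fun s hs ↦ by
      rw [Set.mem_singleton_iff.1 hs]
      exact hTx.trans hσx.symm
  have huniq := atMostOnePrimeOverTwo_of_conj_eq_sq hd hσ T (fun b ↦ RingHom.congr_fun hT b) hF2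
  refine ⟨noTwoTorsion_of_subsingleton_ramifiedPrimes hd hσ ?_ hF, huniq⟩
  have h2 : ∀ P ∈ ramifiedPrimes (𝓞 F) (𝓞 K), (2 : 𝓞 K) ∈ P := fun P hP ↦
    (hP.1.mem_or_mem (two_mul_mem_of_mem_ramifiedPrimes hd hσ hP hσx)).elim id (hx2 P hP.1)
  exact fun P hP Q hQ ↦ huniq ⟨hP.1, h2 P hP⟩ ⟨hQ.1, h2 Q hQ⟩

end PrimesOverTwo

section RealLayers

open Ideal Module NumberField IntermediateField

variable {Ω : Type*} [Field Ω] [CharZero Ω]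

theorem adjoin_preimage_val_eq_top {K : IntermediateField ℚ Ω} {S : Set Ω}
    (hK : K = adjoin ℚ S) : adjoin ℚ ((↑) ⁻¹' S : Set K) = ⊤ := by
  subst hK
  refine eq_top_iff.2 fun z _ ↦ ?_
  obtain ⟨z, hz⟩ := z
  induction hz using IntermediateField.adjoin_induction with
  | mem s hs => exact IntermediateField.subset_adjoin ℚ _ hs
  | algebraMap r =>
    convert (adjoin ℚ ((↑) ⁻¹' S : Set (adjoin ℚ S))).algebraMap_mem r
    exact DFunLike.congr_fun (Subsingleton.elim (algebraMap ℚ Ω)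
      ((algebraMap (adjoin ℚ S) Ω).comp (algebraMap ℚ (adjoin ℚ S)))) r
  | add x y hx hy h1 h2 => exact add_mem (h1 trivial) (h2 trivial)
  | inv x hx h1 => exact inv_mem (h1 trivial)
  | mul x y hx hy h1 h2 => exact mul_mem (h1 trivial) (h2 trivial)

theorem adjoin_inclusion_eq_top {E K : IntermediateField ℚ Ω} (h : E ≤ K) {S : Set Ω}
    (hK : K = adjoin ℚ S) {x : K} (hS : ∀ s ∈ S, s ∈ E ∨ s = x) :
    let := (inclusion h).toRingHom.toAlgebra
    (adjoin E {x} : IntermediateField E K) = ⊤ := by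
  let := (inclusion h).toRingHom.toAlgebra
  have : IsScalarTower ℚ E K := IsScalarTower.of_algebraMap_eq fun r ↦ by simp
  have h1 : adjoin ℚ ((↑) ⁻¹' S : Set K) ≤
      (adjoin E {x} : IntermediateField E K).restrictScalars ℚ := by
    rw [IntermediateField.adjoin_le_iff]
    intro s hs
    rcases hS s hs with h1 | h1
    · exact (adjoin E {x} : IntermediateField E K).algebraMap_mem ⟨s, h1⟩
    · rw [Subtype.ext h1]
      exact IntermediateField.mem_adjoin_simple_self E x
  rw [adjoin_preimage_val_eq_top hK] at h1
  exact eq_top_iff.2 fun z _ ↦ h1 IntermediateField.mem_top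

theorem map_iterate_sq_sub_two {R S : Type*} [CommRing R] [CommRing S] (φ : R →+* S) (n : ℕ)
    (t : R) : φ ((fun t ↦ t ^ 2 - 2)^[n] t) = (fun t ↦ t ^ 2 - 2)^[n] (φ t) :=
  (Function.Semiconj.iterate_right (f := φ) (fun t ↦ by simp [map_ofNat]) n) t

theorem two_mem_of_mem_of_iterate_eq_zero {R : Type*} [CommRing R] {P : Ideal R} {n : ℕ} {t : R}
    (h : (fun t ↦ t ^ 2 - 2)^[n + 1] t = 0) (ht : t ∈ P) : (2 : R) ∈ P := by
  have key : ∀ (n : ℕ) (z : R), z - 2 ∈ P ∨ z + 2 ∈ P → (fun t ↦ t ^ 2 - 2)^[n] z ∈ P →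
      (2 : R) ∈ P := by
    intro n
    induction n with
    | zero =>
      rintro z (h1 | h1) h2
      · simpa using P.sub_mem h2 h1
      · simpa using P.sub_mem h1 h2
    | succ n ih =>
      intro z hz h2
      refine ih (z ^ 2 - 2) (Or.inl ?_) h2
      rw [show z ^ 2 - 2 - 2 = (z - 2) * (z + 2) by ring]
      exact hz.elim (P.mul_mem_right _) (P.mul_mem_left _)
  refine key n (t ^ 2 - 2) (Or.inr ?_) ?_
  · simpa using P.pow_mem_of_mem ht 2 two_pos
  · exact h.symm ▸ P.zero_mem

theorem isIntegral_of_iterate_eq_zero {R : Type*} [CommRing R] {n : ℕ} {t : R}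
    (h : (fun t ↦ t ^ 2 - 2)^[n] t = 0) : IsIntegral ℤ t := by
  induction n generalizing t with
  | zero => exact (show t = 0 from h) ▸ isIntegral_zero
  | succ n ih =>
    refine IsIntegral.of_pow two_pos ?_
    have h2 : IsIntegral ℤ (2 : R) := by
      simpa using isIntegral_algebraMap (R := ℤ) (A := R) (x := 2)
    simpa using (ih h).add h2

variable [Algebra.IsAlgebraic ℚ Ω] {a b : Ω} {p q : ℕ}

instance numberField_adjoin_of_finite (S : Set Ω) [Finite S] : NumberField (adjoin ℚ S) where
  to_finiteDimensional := by
    have : FiniteDimensional ℚ (adjoin ℚ S) :=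
      IntermediateField.finiteDimensional_adjoin fun x _ ↦ Algebra.IsIntegral.isIntegral x
    convert this

theorem isTotallyReal_adjoin (ha : a ^ 2 = p) (hb : b ^ 2 = q) {n : ℕ} {t : Ω}
    (ht : (fun t ↦ t ^ 2 - 2)^[n] t = 0) : IsTotallyReal (adjoin ℚ {a, b, t}) := by
  refine isTotallyReal_of_adjoin_eq_top (adjoin_preimage_val_eq_top rfl) fun φ s hs ↦ ?_
  rcases hs with hs | hs | hs
  · refine conj_eq_of_sq_eq_natCast (m := p) ?_
    rw [← map_pow, ← map_natCast φ]
    exact congrArg φ (Subtype.ext (by simpa [hs] using ha))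
  · refine conj_eq_of_sq_eq_natCast (m := q) ?_
    rw [← map_pow, ← map_natCast φ]
    exact congrArg φ (Subtype.ext (by simpa [hs] using hb))
  · obtain ⟨r, -, hr⟩ := exists_ofReal_eq_of_iterate_eq_zero (n := n) (z := φ s) (by
      rw [← map_iterate_sq_sub_two]
      refine (congrArg φ (Subtype.ext ?_)).trans (map_zero φ)
      have h1 := map_iterate_sq_sub_two (algebraMap (adjoin ℚ {a, b, t}) Ω) n s
      rw [show algebraMap (adjoin ℚ {a, b, t}) Ω s = t from hs, ht] at h1
      exact h1)
    rw [hr, Complex.conj_ofReal]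

end RealLayers

section RealLayersInduction

open Ideal Module NumberField IntermediateField

theorem finrank_le_mul {F K : Type*} [Field F] [Field K] [CharZero F] [CharZero K] [Algebra F K]
    {m n : ℕ} (hF : finrank ℚ F ≤ m) (hK : finrank F K ≤ n) : finrank ℚ K ≤ m * n := by
  rw [← Module.finrank_mul_finrank ℚ F K]
  exact Nat.mul_le_mul hF hK

variable {Ω : Type*} [Field Ω] [CharZero Ω] {a b : Ω} {p q : ℕ}

theorem adjoin_triple_le_adjoin_triple {s t : Ω} (h : t ∈ adjoin ℚ {a, b, s}) :
    adjoin ℚ {a, b, t} ≤ adjoin ℚ {a, b, s} := by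
  rw [IntermediateField.adjoin_le_iff]
  rintro x (rfl | rfl | rfl)
  · exact IntermediateField.subset_adjoin ℚ _ (by simp)
  · exact IntermediateField.subset_adjoin ℚ _ (by simp)
  · exact h

theorem adjoin_zero_le_adjoin_triple (t : Ω) : adjoin ℚ {a, b, 0} ≤ adjoin ℚ {a, b, t} :=
  adjoin_triple_le_adjoin_triple (zero_mem _)

variable [IsGalois ℚ Ω]

theorem noTwoTorsion_adjoin_pair (hpp : p.Prime) (hqp : q.Prime) (hp : p % 8 = 5)
    (hq : q % 8 = 3) (ha : a ^ 2 = p) (hb : b ^ 2 = q) :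
    NoTwoTorsion (𝓞 (adjoin ℚ {a, b, 0})) ∧ finrank ℚ (adjoin ℚ {a, b, 0}) ≤ 4 := by
  have : IsTotallyReal (adjoin ℚ {a, b, 0}) :=
    isTotallyReal_adjoin (n := 0) ha hb rfl
  have hle : adjoin ℚ {b} ≤ adjoin ℚ {a, b, 0} :=
    IntermediateField.adjoin.mono ℚ _ _ (by simp)
  let := (inclusion hle).toRingHom.toAlgebra
  let y : adjoin ℚ {b} := ⟨b, IntermediateField.mem_adjoin_simple_self ℚ b⟩
  let x : adjoin ℚ {a, b, 0} := ⟨a, IntermediateField.subset_adjoin ℚ _ (by simp)⟩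
  have hy : y ^ 2 = q := Subtype.ext (by simpa [y] using hb)
  have hx : x ^ 2 = p := Subtype.ext (by simpa [x] using ha)
  have hytop : (ℚ⟮y⟯ : IntermediateField ℚ (adjoin ℚ {b})) = ⊤ := by
    rw [← adjoin_preimage_val_eq_top (K := adjoin ℚ {b}) rfl]
    congr 1
    ext z
    simp [y, Subtype.ext_iff]
  have hxtop : (adjoin (adjoin ℚ {b}) {x} : IntermediateField (adjoin ℚ {b})
      (adjoin ℚ {a, b, 0})) = ⊤ := by
    refine adjoin_inclusion_eq_top hle rfl ?_
    rintro s (rfl | rfl | rfl)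
    · exact Or.inr rfl
    · exact Or.inl (IntermediateField.mem_adjoin_simple_self ℚ _)
    · exact Or.inl (zero_mem _)
  refine ⟨noTwoTorsion_biquadratic hpp hqp hp hq hy hytop hx hxtop, ?_⟩
  have h1 : finrank ℚ (adjoin ℚ {b}) ≤ 2 :=
    finrank_le_two_of_adjoin_eq_top (d := (q : ℚ)) (by simpa using hy) hytop
  have h2 : finrank (adjoin ℚ {b}) (adjoin ℚ {a, b, 0}) ≤ 2 :=
    finrank_le_two_of_adjoin_eq_top (d := (p : adjoin ℚ {b})) (by simpa using hx) hxtop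
  exact finrank_le_mul h1 h2

theorem exists_algEquiv_neg_of_notMem {E : IntermediateField ℚ Ω} {t : Ω} (ht : t ∉ E)
    (ht2 : t ^ 2 ∈ E) : ∃ g : Ω ≃ₐ[ℚ] Ω, (∀ z ∈ E, g z = z) ∧ g t = -t := by
  have h1 : ¬ ∀ f : Ω ≃ₐ[E] Ω, f t = t := fun h ↦ by
    have h2 := (InfiniteGalois.mem_bot_iff_fixed (k := E) t).2 h
    obtain ⟨z, hz⟩ := IntermediateField.mem_bot.1 h2
    exact ht (hz ▸ z.2)
  push Not at h1
  obtain ⟨f, hf⟩ := h1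
  have h2 : (f t) ^ 2 = t ^ 2 := by
    rw [← map_pow]
    exact f.commutes ⟨t ^ 2, ht2⟩
  exact ⟨f.restrictScalars ℚ, fun z hz ↦ f.commutes ⟨z, hz⟩,
    (sq_eq_sq_iff_eq_or_eq_neg.1 h2).resolve_left hf⟩

theorem noTwoTorsion_adjoin_layer_one (hpp : p.Prime) (hqp : q.Prime) (hp : p % 8 = 5)
    (hq : q % 8 = 3) (ha : a ^ 2 = p) (hb : b ^ 2 = q) {t : Ω} (ht : t ^ 2 = 2) :
    t ∉ adjoin ℚ {a, b, 0} ∧ AtMostOnePrimeOverTwo (𝓞 (adjoin ℚ {a, b, t})) ∧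
      NoTwoTorsion (𝓞 (adjoin ℚ {a, b, t})) := by
  have : IsTotallyReal (adjoin ℚ {a, b, t}) :=
    isTotallyReal_adjoin (n := 1) ha hb (by simp [ht])
  obtain ⟨hF, hF4⟩ := noTwoTorsion_adjoin_pair hpp hqp hp hq ha hb
  have hle : adjoin ℚ {a, b, 0} ≤ adjoin ℚ {a, b, t} := adjoin_zero_le_adjoin_triple t
  let := (inclusion hle).toRingHom.toAlgebra
  let x : adjoin ℚ {a, b, 0} := ⟨a, IntermediateField.subset_adjoin ℚ _ (by simp)⟩
  let y : adjoin ℚ {a, b, 0} := ⟨b, IntermediateField.subset_adjoin ℚ _ (by simp)⟩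
  let r : adjoin ℚ {a, b, t} := ⟨t, IntermediateField.subset_adjoin ℚ _ (by simp)⟩
  have hx : x ^ 2 = p := Subtype.ext (by simpa [x] using ha)
  have hy : y ^ 2 = q := Subtype.ext (by simpa [y] using hb)
  have hr : r ^ 2 = 2 := Subtype.ext ht
  have hrtop : (adjoin (adjoin ℚ {a, b, 0}) {r} : IntermediateField (adjoin ℚ {a, b, 0})
      (adjoin ℚ {a, b, t})) = ⊤ := by
    refine adjoin_inclusion_eq_top hle rfl ?_
    rintro s (rfl | rfl | rfl)
    · exact Or.inl x.2
    · exact Or.inl y.2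
    · exact Or.inr rfl
  obtain ⟨h1, h2, h3⟩ := noTwoTorsion_adjoin_sqrt_two hF hF4 hp hq hx hy hr hrtop
  exact ⟨fun h ↦ h1 ⟨t, h⟩ rfl, h2, h3⟩

theorem noTwoTorsion_adjoin_sqrt_two_add (ha : a ^ 2 = p) (hb : b ^ 2 = q) {n : ℕ} {s t : Ω}
    (hs : s ^ 2 = 2 + t) (ht : (fun t ↦ t ^ 2 - 2)^[n] t = 0)
    (hF : NoTwoTorsion (𝓞 (adjoin ℚ {a, b, t})))
    (hF2 : AtMostOnePrimeOverTwo (𝓞 (adjoin ℚ {a, b, t}))) {g : Ω →+* Ω}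
    (hga : g a = a) (hgb : g b = b) (hg : g s ∈ adjoin ℚ {a, b, s}) (hggt : g (g t) = t)
    (hggs : g (g s) = -s) (hs0 : s ≠ 0) :
    NoTwoTorsion (𝓞 (adjoin ℚ {a, b, s})) ∧ AtMostOnePrimeOverTwo (𝓞 (adjoin ℚ {a, b, s})) := by
  have hsn : (fun t ↦ t ^ 2 - 2)^[n + 1] s = 0 := by
    rw [Function.iterate_succ_apply]
    simpa [hs] using ht
  have : IsTotallyReal (adjoin ℚ {a, b, s}) := isTotallyReal_adjoin (n := n + 1) ha hb hsn
  have hsmem : s ∈ adjoin ℚ {a, b, s} := IntermediateField.subset_adjoin ℚ _ (by simp)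
  have htmem : t ∈ adjoin ℚ {a, b, s} := by
    rw [show t = s ^ 2 - 2 by rw [hs]; ring]
    exact sub_mem (pow_mem hsmem 2) (ofNat_mem _ 2)
  have hle : adjoin ℚ {a, b, t} ≤ adjoin ℚ {a, b, s} := adjoin_triple_le_adjoin_triple htmem
  let := (inclusion hle).toRingHom.toAlgebra
  let x : 𝓞 (adjoin ℚ {a, b, s}) := ⟨⟨s, hsmem⟩, by
    have h1 := isIntegral_of_iterate_eq_zero hsn
    exact (isIntegral_algHom_iff ((adjoin ℚ {a, b, s}).val.restrictScalars ℤ)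
      Subtype.val_injective).1 h1⟩
  let d : adjoin ℚ {a, b, t} := 2 + ⟨t, IntermediateField.subset_adjoin ℚ _ (by simp)⟩
  have hxd : (x : adjoin ℚ {a, b, s}) ^ 2 = algebraMap (adjoin ℚ {a, b, t}) _ d :=
    Subtype.ext hs
  have htop : (adjoin (adjoin ℚ {a, b, t}) {(x : adjoin ℚ {a, b, s})} :
      IntermediateField (adjoin ℚ {a, b, t}) (adjoin ℚ {a, b, s})) = ⊤ := by
    refine adjoin_inclusion_eq_top hle rfl ?_
    rintro z (rfl | rfl | rfl)
    · exact Or.inl (IntermediateField.subset_adjoin ℚ _ (by simp))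
    · exact Or.inl (IntermediateField.subset_adjoin ℚ _ (by simp))
    · exact Or.inr rfl
  have hxn : (fun t ↦ t ^ 2 - 2)^[n + 1] x = 0 := by
    apply RingOfIntegers.coe_injective
    apply Subtype.val_injective
    have h1 := map_iterate_sq_sub_two ((algebraMap (adjoin ℚ {a, b, s}) Ω).comp
      (algebraMap (𝓞 (adjoin ℚ {a, b, s})) _)) (n + 1) x
    exact h1.trans hsn
  have hgmem (z : Ω) (hz : z ∈ adjoin ℚ {a, b, s}) : g z ∈ adjoin ℚ {a, b, s} := by
    induction hz using IntermediateField.adjoin_induction with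
    | mem z hz =>
      rcases hz with rfl | rfl | rfl
      · rw [hga]
        exact IntermediateField.subset_adjoin ℚ _ (by simp)
      · rw [hgb]
        exact IntermediateField.subset_adjoin ℚ _ (by simp)
      · exact hg
    | algebraMap r =>
      rw [eq_ratCast, map_ratCast]
      exact SubfieldClass.ratCast_mem _ r
    | add x y hx hy h1 h2 => exact map_add g x y ▸ add_mem h1 h2
    | inv x hx h1 => exact map_inv₀ g x ▸ inv_mem h1
    | mul x y hx hy h1 h2 => exact map_mul g x y ▸ mul_mem h1 h2
  have hgg (z : Ω) (hz : z ∈ adjoin ℚ {a, b, t}) : g (g z) = z := by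
    induction hz using IntermediateField.adjoin_induction with
    | mem z hz =>
      rcases hz with rfl | rfl | rfl
      · rw [hga, hga]
      · rw [hgb, hgb]
      · exact hggt
    | algebraMap r => simp
    | add x y hx hy h1 h2 => rw [map_add, map_add, h1, h2]
    | inv x hx h1 => rw [map_inv₀, map_inv₀, h1]
    | mul x y hx hy h1 h2 => rw [map_mul, map_mul, h1, h2]
  exact noTwoTorsion_of_sq_conj hF hF2 hxd htop
    (fun P _ hP ↦ two_mem_of_mem_of_iterate_eq_zero hxn hP)
    (T := g.restrict (adjoin ℚ {a, b, s}) (adjoin ℚ {a, b, s}) hgmem)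
    (fun z ↦ Subtype.ext (hgg z z.2)) (Subtype.ext hggs)
    (fun h ↦ hs0 (congrArg (fun z : 𝓞 (adjoin ℚ {a, b, s}) ↦ ((z : adjoin ℚ {a, b, s}) : Ω)) h))

theorem noTwoTorsion_adjoin_layer (hpp : p.Prime) (hqp : q.Prime) (hp : p % 8 = 5)
    (hq : q % 8 = 3) (ha : a ^ 2 = p) (hb : b ^ 2 = q) (n : ℕ) {t : Ω}
    (ht : (fun t ↦ t ^ 2 - 2)^[n + 1] t = 0) :
    (∃ g : Ω →+* Ω, g a = a ∧ g b = b ∧ g t = -t ∧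
      ∃ c ∈ adjoin ℚ {a, b, t}, c ^ 2 = 4 - t ^ 2 ∧ g c = -c) ∧
    AtMostOnePrimeOverTwo (𝓞 (adjoin ℚ {a, b, t})) ∧
      NoTwoTorsion (𝓞 (adjoin ℚ {a, b, t})) := by
  induction n generalizing t with
  | zero =>
    have ht2 : t ^ 2 = 2 := sub_eq_zero.1 ht
    obtain ⟨h1, h2, h3⟩ := noTwoTorsion_adjoin_layer_one hpp hqp hp hq ha hb ht2
    obtain ⟨g, hgE, hg⟩ := exists_algEquiv_neg_of_notMem h1 (ht2 ▸ ofNat_mem _ 2)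
    exact ⟨⟨g, hgE a (IntermediateField.subset_adjoin ℚ _ (by simp)),
      hgE b (IntermediateField.subset_adjoin ℚ _ (by simp)), hg, t,
      IntermediateField.subset_adjoin ℚ _ (by simp), by rw [ht2]; norm_num, hg⟩, h2, h3⟩
  | succ n ih =>
    rw [Function.iterate_succ_apply] at ht
    obtain ⟨⟨g, hga, hgb, hgt, c, hc, hc2, hgc⟩, h2, h3⟩ := ih ht
    have ht2 : t ^ 2 = 2 + (t ^ 2 - 2) := by ring
    have htmem : t ∈ adjoin ℚ {a, b, t} := IntermediateField.subset_adjoin ℚ _ (by simp)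
    have hle : adjoin ℚ {a, b, t ^ 2 - 2} ≤ adjoin ℚ {a, b, t} :=
      adjoin_triple_le_adjoin_triple (sub_mem (pow_mem htmem 2) (ofNat_mem _ 2))
    have ht0 : t ≠ 0 := by
      rintro rfl
      norm_num [map_ofNat] at hgt
    have hct : (c / t) ^ 2 = 4 - t ^ 2 := by
      rw [div_pow, hc2, div_eq_iff (pow_ne_zero 2 ht0)]
      ring
    have hg2 : (g t) ^ 2 = (c / t) ^ 2 := by
      rw [hct, ← map_pow]
      calc g (t ^ 2) = g (t ^ 2 - 2) + 2 := by simp [map_ofNat]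
        _ = _ := by rw [hgt]; ring
    have hgtt : g t = c / t ∨ g t = -(c / t) := sq_eq_sq_iff_eq_or_eq_neg.1 hg2
    have hctmem : c / t ∈ adjoin ℚ {a, b, t} := div_mem (hle hc) htmem
    have hc0 : c / t ≠ 0 := by
      intro h
      rw [h, neg_zero, or_self] at hgtt
      exact ht0 (g.injective (hgtt.trans (map_zero g).symm))
    have hgct : g (c / t) * g t = -c := by rw [← map_mul, div_mul_cancel₀ _ ht0, hgc]
    have hggt : g (g t) = -t := by
      rcases hgtt with h | h
      · refine mul_right_cancel₀ hc0 ?_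
        rw [h] at hgct ⊢
        rw [hgct, neg_mul, mul_div_cancel₀ _ ht0]
      · refine mul_right_cancel₀ hc0 ?_
        rw [h] at hgct ⊢
        rw [map_neg, neg_mul, neg_mul, mul_div_cancel₀ _ ht0, ← mul_neg, hgct]
    have hggc : g (g (c / t)) = -(c / t) := by
      rcases hgtt with h | h
      · rw [← h, hggt, map_neg]
      · have h5 : c / t = -g t := by rw [h, neg_neg]
        rw [h5, map_neg, map_neg, hggt, map_neg]
    have hmem : g t ∈ adjoin ℚ {a, b, t} := by
      rcases hgtt with h | h
      · exact h ▸ hctmem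
      · exact h ▸ neg_mem hctmem
    obtain ⟨h4, h5⟩ := noTwoTorsion_adjoin_sqrt_two_add ha hb ht2 ht h3 h2 hga hgb hmem
      (by rw [hgt, map_neg, hgt, neg_neg]) hggt ht0
    exact ⟨⟨g.comp g, by simp [hga], by simp [hgb], hggt, c / t, hctmem, hct, hggc⟩, h5, h4⟩

end RealLayersInduction

section ComplexLayers

open Module NumberField IntermediateField

theorem iterate_sq_sub_two_add_inv {F : Type*} [Field F] {z : F} (hz : z ≠ 0) (n : ℕ) :
    (fun t ↦ t ^ 2 - 2)^[n] (z + z⁻¹) = z ^ 2 ^ n + (z ^ 2 ^ n)⁻¹ := by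
  induction n with
  | zero => simp
  | succ n ih =>
    rw [Function.iterate_succ_apply', ih, pow_succ 2 n, pow_mul]
    have h := pow_ne_zero (2 ^ n) hz
    field_simp
    ring

theorem iterate_sq_sub_two_add_inv_eq_zero {F : Type*} [Field F] {z : F} {n : ℕ}
    (hz : IsPrimitiveRoot z (2 ^ (n + 2))) : (fun t ↦ t ^ 2 - 2)^[n] (z + z⁻¹) = 0 := by
  have hz0 : z ≠ 0 := hz.ne_zero (by positivity)
  have h2 : IsPrimitiveRoot ((z ^ 2 ^ n) ^ 2) 2 := by
    rw [← pow_mul, ← pow_succ]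
    exact hz.pow (by positivity) (by ring)
  have h3 := h2.eq_neg_one_of_two_right
  have h := pow_ne_zero (2 ^ n) hz0
  rw [iterate_sq_sub_two_add_inv hz0]
  field_simp
  rw [h3]
  ring

theorem noTwoTorsion_adjoin_map {Ω : Type*} [Field Ω] [CharZero Ω] [Algebra ℚ Ω]
    (φ : Ω →ₐ[ℚ] ℂ) (S : Set Ω) (h : NoTwoTorsion (𝓞 (adjoin ℚ S))) :
    NoTwoTorsion (𝓞 (adjoin ℚ (φ '' S))) := by
  rw [← IntermediateField.adjoin_map]
  exact h.of_ringEquiv (RingOfIntegers.mapRingEquiv ((adjoin ℚ S).equivMap φ))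

theorem odd_card_classGroup_adjoin {p q : ℕ} (hpp : p.Prime) (hqp : q.Prime) (hp : p % 8 = 5)
    (hq : q % 8 = 3) {a b t : ℂ} (ha : a ^ 2 = p) (hb : b ^ 2 = q) {n : ℕ}
    (ht : (fun t ↦ t ^ 2 - 2)^[n + 1] t = 0) :
    Odd (Nat.card (ClassGroup (𝓞 (adjoin ℚ {a, b, t})))) := by
  have hia : IsIntegral ℚ a :=
    (IsIntegral.of_pow two_pos (ha ▸ isIntegral_natCast _) : IsIntegral ℤ a).tower_top
  have hib : IsIntegral ℚ b :=
    (IsIntegral.of_pow two_pos (hb ▸ isIntegral_natCast _) : IsIntegral ℤ b).tower_top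
  have hit : IsIntegral ℚ t := (isIntegral_of_iterate_eq_zero ht).tower_top
  have : NumberField (adjoin ℚ {a, b, t}) := by
    have : FiniteDimensional ℚ (adjoin ℚ {a, b, t}) := by
      refine IntermediateField.finiteDimensional_adjoin ?_
      rintro x (rfl | rfl | rfl) <;> assumption
    exact { to_finiteDimensional := by convert this }
  let Ω := algebraicClosure ℚ ℂ
  have : IsGalois ℚ Ω := by
    have := algebraicClosure.isAlgClosure (F := ℚ) (E := ℂ)
    have := @IsAlgClosure.isGalois ℚ Ω _ _ _ this _
    convert this
  let a' : Ω := ⟨a, hia⟩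
  let b' : Ω := ⟨b, hib⟩
  let t' : Ω := ⟨t, hit⟩
  have ht' : (fun t ↦ t ^ 2 - 2)^[n + 1] t' = 0 :=
    Subtype.ext ((map_iterate_sq_sub_two (algebraMap Ω ℂ) _ _).trans ht)
  have h := (noTwoTorsion_adjoin_layer hpp hqp hp hq (Subtype.ext ha : a' ^ 2 = p)
    (Subtype.ext hb : b' ^ 2 = q) n ht').2.2
  have himage : (algebraMap Ω ℂ) '' {a', b', t'} = {a, b, t} := by
    rw [Set.image_insert_eq, Set.image_insert_eq, Set.image_singleton]
    rfl
  refine NoTwoTorsion.odd_card_classGroup ?_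
  rw [← himage]
  exact noTwoTorsion_adjoin_map (RingHom.toRatAlgHom (algebraMap Ω ℂ)) _ h

end ComplexLayers

theorem odd_classNumber_real_layers
    (p q : ℕ) [Fact (Nat.Prime p)] [Fact (Nat.Prime q)]
    (hp : p % 8 = 5) (hq : q % 8 = 3) :
    ∀ n : ℕ, 1 ≤ n → ∀ ζ : ℂ, IsPrimitiveRoot ζ (2 ^ (n + 2)) →
      Odd (classNum (IntermediateField.adjoin ℚ
        {((Real.sqrt p : ℝ) : ℂ), ((Real.sqrt q : ℝ) : ℂ), ζ + ζ⁻¹})) ∧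
      TwoClassGroupIsTrivial (IntermediateField.adjoin ℚ
        {((Real.sqrt p : ℝ) : ℂ), ((Real.sqrt q : ℝ) : ℂ), ζ + ζ⁻¹}) := by
  intro n hn ζ hζ
  obtain ⟨m, rfl⟩ := Nat.exists_eq_add_of_le' hn
  have hsq (k : ℕ) : ((Real.sqrt k : ℝ) : ℂ) ^ 2 = k := by
    rw [← Complex.ofReal_pow, Real.sq_sqrt k.cast_nonneg, Complex.ofReal_natCast]
  have h := odd_card_classGroup_adjoin Fact.out Fact.out hp hq (hsq p) (hsq q)
    (iterate_sq_sub_two_add_inv_eq_zero hζ)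
  exact ⟨h, sylow_two_eq_bot_of_odd_card h⟩
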